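/- arXiv:1708.01510 — 6 statements merged into one kernel-verified Lean document; each statement's English description precedes it below -/
import Mathlib

section
/- Let d ≥ 2 and let K, L ⊆ ℝ^d be closed convex sets with nonempty interior, with K ≠ ℝ^d and L ≠ ℝ^d, both satisfying condition (A), and such that at least one of K and L has an extreme point. Then the following are equivalent: (1) for all orientation-preserving surjective isometries φ, ψ of ℝ^d, if φ(K) ∩ ψ(L) is compact and has nonempty interior then φ(K) ∩ ψ(L) is centrally symmetric; (2) K and L are congruent balls, i.e. there exist r > 0 and points c, c′ with K the closed ball of radius r about c and L the closed ball of radius r about c′. -/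
open Metric Set

noncomputable section

/-- Euclidean `d`-space. -/
abbrev Euc (d : ℕ) := EuclideanSpace ℝ (Fin d)

/-- A set is centrally symmetric if some point reflection `x ↦ 2c − x` maps it onto itself. -/
def CentrallySymmetric {d : ℕ} (S : Set (Euc d)) : Prop :=
  ∃ c : Euc d, (fun x => (2 : ℝ) • c - x) '' S = S

/-- An affine isometry (congruence) of Euclidean space is orientation preserving if its
linear part has determinant `1`. -/
def OrientationPreserving {d : ℕ} (φ : Euc d ≃ᵃⁱ[ℝ] Euc d) : Prop :=
  LinearMap.det (φ.linearIsometryEquiv.toLinearEquiv : Euc d →ₗ[ℝ] Euc d) = 1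

/-- Condition (A): every frontier point of `K` lies on the boundary of some ball
contained in `K`. -/
def CondA {d : ℕ} (K : Set (Euc d)) : Prop :=
  ∀ x ∈ frontier K, ∃ ε₁ : ℝ, 0 < ε₁ ∧ ∃ c : Euc d, dist x c = ε₁ ∧ closedBall c ε₁ ⊆ K

/-- `K` has an extreme point: a point of `K` not lying in the open segment joining two
distinct points of `K`. -/
def HasExtremePoint {d : ℕ} (K : Set (Euc d)) : Prop :=
  ∃ x ∈ K, ∀ y ∈ K, ∀ z ∈ K, y ≠ z → x ∉ openSegment ℝ y z

/-- `x` is a point of `K` and the hyperplane through `x` with outer unit normal `u`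
supports `K`. -/
def IsSupportedAt {d : ℕ} (K : Set (Euc d)) (x u : Euc d) : Prop :=
  x ∈ K ∧ ‖u‖ = 1 ∧ ∀ z ∈ K, inner ℝ (z - x) u ≤ 0

/-- Within distance `η` of `x`, the set `K` is contained in the ball of radius `R` whose boundary
passes through `x` with outer unit normal `u`. -/
def IsLocallyEnclosedAt {d : ℕ} (K : Set (Euc d)) (x u : Euc d) (R η : ℝ) : Prop :=
  ∀ z ∈ K, ‖z - x‖ ≤ η → ‖z - x‖ ^ 2 + 2 * R * inner ℝ (z - x) u ≤ 0

/-- A linear isometry of determinant one. -/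
def IsRotation {d : ℕ} (σ : Euc d ≃ₗᵢ[ℝ] Euc d) : Prop :=
  LinearMap.det (σ.toLinearEquiv : Euc d →ₗ[ℝ] Euc d) = 1

/-- Every compact intersection with nonempty interior of `K` with an orientation preserving
congruent copy of `L` is centrally symmetric. -/
def HasSymmetricIntersections {d : ℕ} (K L : Set (Euc d)) : Prop :=
  ∀ ψ : Euc d ≃ᵃⁱ[ℝ] Euc d, OrientationPreserving ψ → IsCompact (K ∩ ψ '' L) →
    (interior (K ∩ ψ '' L)).Nonempty → CentrallySymmetric (K ∩ ψ '' L)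

section Rotations

variable {d : ℕ}

theorem IsRotation.trans {σ τ : Euc d ≃ₗᵢ[ℝ] Euc d} (hσ : IsRotation σ) (hτ : IsRotation τ) :
    IsRotation (σ.trans τ) := by
  unfold IsRotation at *
  have : ((σ.trans τ).toLinearEquiv : Euc d →ₗ[ℝ] Euc d) =
      (τ.toLinearEquiv : Euc d →ₗ[ℝ] Euc d) ∘ₗ (σ.toLinearEquiv : Euc d →ₗ[ℝ] Euc d) := rfl
  rw [this, LinearMap.det_comp, hσ, hτ, one_mul]

theorem det_reflection_orthogonal_singleton {v : Euc d} (hv : v ≠ 0) :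
    LinearMap.det ((ℝ ∙ v)ᗮ.reflection.toLinearEquiv : Euc d →ₗ[ℝ] Euc d) = -1 := by
  have h := Submodule.det_reflection (ℝ ∙ v)ᗮ
  rw [Submodule.orthogonal_orthogonal, finrank_span_singleton hv, pow_one] at h
  exact h

theorem exists_ne_zero_inner_eq_zero (hd : 2 ≤ d) (u : Euc d) :
    ∃ w : Euc d, w ≠ 0 ∧ inner ℝ w u = 0 := by
  have h1 := Submodule.finrank_add_finrank_orthogonal (ℝ ∙ u)
  have h2 := finrank_span_le_card (R := ℝ) ({u} : Set (Euc d))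
  have h3 : Module.finrank ℝ (Euc d) = d := by simp
  have h4 : 0 < Module.finrank ℝ (ℝ ∙ u)ᗮ := by
    simp only [Set.toFinset_singleton, Finset.card_singleton] at h2
    omega
  obtain ⟨w, hw⟩ := Module.finrank_pos_iff_exists_ne_zero.1 h4
  refine ⟨w, by simpa using hw, ?_⟩
  exact Submodule.mem_orthogonal_singleton_iff_inner_left.1 w.2

theorem exists_isRotation_map_eq (hd : 2 ≤ d) {u v : Euc d} (h : ‖v‖ = ‖u‖) :
    ∃ σ : Euc d ≃ₗᵢ[ℝ] Euc d, IsRotation σ ∧ σ v = u := by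
  by_cases huv : v = u
  · refine ⟨LinearIsometryEquiv.refl ℝ _, ?_, by simp [huv]⟩
    exact LinearMap.det_id
  obtain ⟨w, hw, hwu⟩ := exists_ne_zero_inner_eq_zero hd u
  refine ⟨((ℝ ∙ (v - u))ᗮ.reflection).trans (ℝ ∙ w)ᗮ.reflection, ?_, ?_⟩
  · unfold IsRotation
    have e : ((((ℝ ∙ (v - u))ᗮ.reflection).trans (ℝ ∙ w)ᗮ.reflection).toLinearEquiv :
        Euc d →ₗ[ℝ] Euc d) = ((ℝ ∙ w)ᗮ.reflection.toLinearEquiv : Euc d →ₗ[ℝ] Euc d) ∘ₗ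
        ((ℝ ∙ (v - u))ᗮ.reflection.toLinearEquiv : Euc d →ₗ[ℝ] Euc d) := rfl
    rw [e, LinearMap.det_comp, det_reflection_orthogonal_singleton hw,
      det_reflection_orthogonal_singleton (sub_ne_zero.2 huv)]
    norm_num
  · rw [LinearIsometryEquiv.trans_apply, Submodule.reflection_sub h]
    apply Submodule.reflection_mem_subspace_eq_self
    exact Submodule.mem_orthogonal_singleton_iff_inner_right.2 hwu

/-- The affine isometry `z ↦ a + σ (z - y)`. -/
def rotateAndMove (σ : Euc d ≃ₗᵢ[ℝ] Euc d) (y a : Euc d) : Euc d ≃ᵃⁱ[ℝ] Euc d :=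
  AffineIsometryEquiv.mk' (fun z => a + σ (z - y)) σ y (fun z => by simp [add_comm])

theorem rotateAndMove_apply (σ : Euc d ≃ₗᵢ[ℝ] Euc d) (y a z : Euc d) :
    rotateAndMove σ y a z = a + σ (z - y) := rfl

theorem orientationPreserving_rotateAndMove {σ : Euc d ≃ₗᵢ[ℝ] Euc d} (h : IsRotation σ)
    (y a : Euc d) : OrientationPreserving (rotateAndMove σ y a) := by
  unfold OrientationPreserving
  rwa [rotateAndMove, AffineIsometryEquiv.linearIsometryEquiv_mk']

theorem mem_image_rotateAndMove {σ : Euc d ≃ₗᵢ[ℝ] Euc d} {y a p : Euc d} {L : Set (Euc d)} :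
    p ∈ rotateAndMove σ y a '' L ↔ y + σ.symm (p - a) ∈ L := by
  constructor
  · rintro ⟨z, hz, rfl⟩
    simpa [rotateAndMove_apply] using hz
  · intro h
    exact ⟨_, h, by simp [rotateAndMove_apply]⟩

end Rotations

section Support

variable {d : ℕ}

theorem inner_le_of_local {K : Set (Euc d)} (hK : Convex ℝ K) {x u : Euc d} (hx : x ∈ K)
    {δ : ℝ} (hδ : 0 < δ) (h : ∀ z ∈ K, ‖z - x‖ < δ → inner ℝ (z - x) u ≤ 0) :
    ∀ z ∈ K, inner ℝ (z - x) u ≤ 0 := by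
  intro z hz
  have hp : 0 < ‖z - x‖ + 1 := by positivity
  set t : ℝ := min 1 (δ / (2 * (‖z - x‖ + 1))) with ht
  have ht0 : 0 < t := lt_min one_pos (by positivity)
  have ht1 : t ≤ 1 := min_le_left _ _
  have hz' := h (x + t • (z - x)) (hK.add_smul_sub_mem hx hz ⟨ht0.le, ht1⟩) (by
    rw [add_sub_cancel_left, norm_smul, Real.norm_of_nonneg ht0.le]
    have h2 : t ≤ δ / (2 * (‖z - x‖ + 1)) := min_le_right _ _
    rw [le_div_iff₀ (by positivity)] at h2
    nlinarith [norm_nonneg (z - x)])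
  rw [add_sub_cancel_left, real_inner_smul_left] at hz'
  by_contra! hc
  nlinarith [mul_pos ht0 hc]

theorem IsLocallyEnclosedAt.inner_le {K : Set (Euc d)} (hK : Convex ℝ K) {x u : Euc d} {R η : ℝ}
    (hx : x ∈ K) (hR : 0 < R) (hη : 0 < η) (h : IsLocallyEnclosedAt K x u R η) :
    ∀ z ∈ K, inner ℝ (z - x) u ≤ 0 := by
  refine inner_le_of_local hK hx hη fun z hz hzx => ?_
  have := h z hz hzx.le
  by_contra! hc
  nlinarith [mul_pos hR hc, sq_nonneg ‖z - x‖]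

theorem IsLocallyEnclosedAt.mul_norm_le {K : Set (Euc d)} (hK : Convex ℝ K) {x u : Euc d}
    {R η : ℝ} (hx : x ∈ K) (hη : 0 < η) (h : IsLocallyEnclosedAt K x u R η)
    {z : Euc d} (hz : z ∈ K) (hzx : η ≤ ‖z - x‖) :
    η * ‖z - x‖ + 2 * R * inner ℝ (z - x) u ≤ 0 := by
  have hp : 0 < ‖z - x‖ := hη.trans_le hzx
  set t : ℝ := η / ‖z - x‖ with ht
  have ht0 : 0 < t := by positivity
  have ht1 : t ≤ 1 := (div_le_one hp).2 hzx
  have hn : ‖t • (z - x)‖ = η := by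
    rw [norm_smul, Real.norm_of_nonneg ht0.le, ht, div_mul_cancel₀ _ hp.ne']
  have hz' := h (x + t • (z - x)) (hK.add_smul_sub_mem hx hz ⟨ht0.le, ht1⟩) (by
    rw [add_sub_cancel_left, hn])
  rw [add_sub_cancel_left, hn, real_inner_smul_left] at hz'
  have e : η = t * ‖z - x‖ := by rw [ht, div_mul_cancel₀ _ hp.ne']
  have h2 : t * (η * ‖z - x‖ + 2 * R * inner ℝ (z - x) u) ≤ 0 := by
    have : t * (η * ‖z - x‖ + 2 * R * inner ℝ (z - x) u) =
      η * (t * ‖z - x‖) + 2 * R * (t * inner ℝ (z - x) u) := by ring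
    rw [this, ← e]; linarith [sq η]
  by_contra! hc
  nlinarith [mul_pos ht0 hc]

/-- A ball inside `K` touching a supporting hyperplane is centred on the inner normal. -/
theorem IsSupportedAt.center_eq {K : Set (Euc d)} {x n a : Euc d} {s : ℝ}
    (h : IsSupportedAt K x n) (hs : 0 ≤ s) (hxa : dist x a = s) (hK : closedBall a s ⊆ K) :
    a = x - s • n := by
  obtain ⟨-, hn, hsup⟩ := h
  have h1 : a + s • n ∈ K := hK (by simp [norm_smul, hn, abs_of_nonneg hs])
  have h2 := hsup _ h1
  have e : a + s • n - x = s • n - (x - a) := by abel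
  rw [e, inner_sub_left, real_inner_smul_left, real_inner_self_eq_norm_sq, hn] at h2
  rw [dist_eq_norm] at hxa
  have h3 : ‖x - a - s • n‖ ^ 2 ≤ 0 := by
    rw [norm_sub_sq_real, real_inner_smul_right, norm_smul, hn, hxa, Real.norm_of_nonneg hs]
    nlinarith
  have h4 : x - a - s • n = 0 := by
    rw [← norm_eq_zero]; nlinarith [norm_nonneg (x - a - s • n)]
  rw [← sub_eq_zero, ← neg_eq_zero, ← h4]; abel

theorem IsSupportedAt.mem_frontier {K : Set (Euc d)} {x n : Euc d} (h : IsSupportedAt K x n) :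
    x ∈ frontier K := by
  obtain ⟨hx, hn, hsup⟩ := h
  refine ⟨subset_closure hx, fun hi => ?_⟩
  obtain ⟨ε, hε, hb⟩ := Metric.isOpen_iff.1 isOpen_interior x hi
  have h1 : x + (ε / 2) • n ∈ K := interior_subset (hb (by
    simp [norm_smul, hn, abs_of_pos hε]; linarith))
  have h2 := hsup _ h1
  rw [add_sub_cancel_left, real_inner_smul_left, real_inner_self_eq_norm_sq, hn] at h2
  linarith

theorem exists_unit_of_functional (f : StrongDual ℝ (Euc d)) (hf : f ≠ 0) :
    ∃ n : Euc d, ‖n‖ = 1 ∧ ∃ c : ℝ, 0 < c ∧ ∀ z, f z = c * inner ℝ z n := by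
  set w := (InnerProductSpace.toDual ℝ (Euc d)).symm f with hw
  have hw0 : w ≠ 0 := by simpa [hw] using hf
  refine ⟨‖w‖⁻¹ • w, norm_smul_inv_norm hw0, ‖w‖, norm_pos_iff.2 hw0, fun z => ?_⟩
  rw [real_inner_smul_right, mul_inv_cancel_left₀ (norm_ne_zero_iff.2 hw0), real_inner_comm, hw,
    InnerProductSpace.toDual_symm_apply]

theorem exists_isSupportedAt {K : Set (Euc d)} (hcl : IsClosed K) (hK : Convex ℝ K)
    (hi : (interior K).Nonempty) {x : Euc d} (hx : x ∈ frontier K) :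
    ∃ n, IsSupportedAt K x n := by
  obtain ⟨f, hf⟩ := geometric_hahn_banach_open_point hK.interior isOpen_interior hx.2
  have hf0 : f ≠ 0 := by
    rintro rfl
    obtain ⟨a, ha⟩ := hi
    simpa using hf a ha
  obtain ⟨n, hn, c, hc, hfn⟩ := exists_unit_of_functional f hf0
  refine ⟨n, hcl.frontier_subset hx, hn, fun z hz => ?_⟩
  have h1 : f z ≤ f x := by
    have : z ∈ closure (interior K) := by
      rw [hK.closure_interior_eq_closure_of_nonempty_interior hi]; exact subset_closure hz
    exact closure_minimal (fun a ha => (hf a ha).le)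
      (isClosed_le f.continuous continuous_const) this
  rw [hfn, hfn] at h1
  rw [inner_sub_left]
  nlinarith [le_of_mul_le_mul_left h1 hc]

theorem exists_inner_ball {K : Set (Euc d)} (hA : CondA K) {x n : Euc d}
    (h : IsSupportedAt K x n) :
    ∃ s : ℝ, 0 < s ∧ ∀ t, 0 < t → t ≤ s → closedBall (x - t • n) t ⊆ K := by
  obtain ⟨s, hs, a, hxa, hb⟩ := hA x h.mem_frontier
  refine ⟨s, hs, fun t ht hts => ?_⟩
  rw [h.center_eq hs.le hxa hb] at hb
  refine (closedBall_subset_closedBall' ?_).trans hb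
  rw [dist_eq_norm]
  have : x - t • n - (x - s • n) = (s - t) • n := by rw [sub_smul]; abel
  rw [this, norm_smul, h.2.1, Real.norm_of_nonneg (by linarith)]
  linarith

end Support

section LocalCongruence

variable {d : ℕ}

theorem CondA.image {L : Set (Euc d)} (hA : CondA L) (ψ : Euc d ≃ᵃⁱ[ℝ] Euc d) :
    CondA (ψ '' L) := by
  intro x hx
  have h : x ∈ ψ '' frontier L := by
    have := ψ.toHomeomorph.image_frontier L
    rw [AffineIsometryEquiv.coe_toHomeomorph] at this
    rwa [this]
  obtain ⟨y, hy, rfl⟩ := h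
  obtain ⟨s, hs, c, hc, hb⟩ := hA y hy
  refine ⟨s, hs, ψ c, by rw [ψ.dist_map, hc], ?_⟩
  exact (ψ.toIsometryEquiv.image_closedBall c s).symm.subset.trans (image_mono hb)

/-- If `K ∩ M` is symmetric about `c`, then a boundary point of `M` whose reflection is interior
to `K` is at distance at least the inradius of `M` from `c`. -/
theorem le_norm_sub_center {K M : Set (Euc d)} {c q w : Euc d} {ρ : ℝ} (hMcl : IsClosed M)
    (hM : Convex ℝ M) (hMA : CondA M) (hρ : 0 < ρ) (hb : closedBall q ρ ⊆ M)
    (hS : ∀ z ∈ K ∩ M, (2 : ℝ) • c - z ∈ K ∩ M) (hw : w ∈ K) (hwM : w ∈ frontier M)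
    (hm : (2 : ℝ) • c - w ∈ interior K) : ρ ≤ ‖w - c‖ := by
  have hMi : (interior M).Nonempty :=
    ⟨q, interior_mono hb (ball_subset_interior_closedBall (mem_ball_self hρ))⟩
  set m := (2 : ℝ) • c - w with hmdef
  have hwM' : w ∈ M := hMcl.frontier_subset hwM
  have hmM : m ∈ M := (hS w ⟨hw, hwM'⟩).2
  obtain ⟨ε, hε, hεK⟩ := Metric.isOpen_iff.1 isOpen_interior m hm
  have hmf : m ∈ frontier M := by
    refine ⟨subset_closure hmM, fun hi => hwM.2 ?_⟩
    obtain ⟨ε', hε', hεM⟩ := Metric.isOpen_iff.1 isOpen_interior m hi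
    refine mem_interior.2 ⟨ball w (min ε ε'), fun z hz => ?_, isOpen_ball,
      mem_ball_self (lt_min hε hε')⟩
    have h1 : dist ((2 : ℝ) • c - z) m = dist z w := by
      rw [hmdef, dist_sub_left]
    have h2 : dist z w < min ε ε' := hz
    have h3 := hS ((2 : ℝ) • c - z)
      ⟨interior_subset (hεK (by rw [mem_ball, h1]; exact h2.trans_le (min_le_left _ _))),
        interior_subset (hεM (by rw [mem_ball, h1]; exact h2.trans_le (min_le_right _ _)))⟩
    rw [sub_sub_cancel] at h3
    exact h3.2
  obtain ⟨n, hn⟩ := exists_isSupportedAt hMcl hM hMi hwM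
  obtain ⟨n', hn'⟩ := exists_isSupportedAt hMcl hM hMi hmf
  obtain ⟨s, hs, hball⟩ := exists_inner_ball hMA hn'
  set t := min s (ε / 3) with ht
  have ht0 : 0 < t := lt_min hs (by positivity)
  have hts : t ≤ s := min_le_left _ _
  have htε : t ≤ ε / 3 := min_le_right _ _
  have hcen : w + t • n' = w - t • n := by
    refine hn.center_eq ht0.le (by simp [norm_smul, hn'.2.1, abs_of_pos ht0]) fun z hz => ?_
    have h1 : (2 : ℝ) • c - z ∈ closedBall (m - t • n') t := by
      rw [mem_closedBall, dist_eq_norm] at hz ⊢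
      have e : (2 : ℝ) • c - z - (m - t • n') = -(z - (w + t • n')) := by rw [hmdef]; abel
      rwa [e, norm_neg]
    have h2 : (2 : ℝ) • c - z ∈ ball m ε := by
      rw [mem_closedBall] at h1
      rw [mem_ball]
      have : dist (m - t • n') m = t := by simp [norm_smul, hn'.2.1, abs_of_pos ht0]
      linarith [dist_triangle ((2 : ℝ) • c - z) (m - t • n') m]
    have h3 := hS _ ⟨interior_subset (hεK h2), hball t ht0 hts h1⟩
    rw [sub_sub_cancel] at h3
    exact h3.2
  have hnn : n' = -n := by
    rw [sub_eq_add_neg, ← smul_neg] at hcen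
    exact smul_right_injective _ ht0.ne' (add_left_cancel hcen)
  have hn1 := hn.2.1
  have e1 := hn.2.2 (q + ρ • n) (hb (by simp [norm_smul, hn1, abs_of_pos hρ]))
  have e2 := hn'.2.2 (q - ρ • n) (hb (by simp [norm_smul, hn1, abs_of_pos hρ]))
  have e3 := real_inner_le_norm (w - c) n
  rw [hn1, mul_one] at e3
  rw [hnn, inner_neg_right] at e2
  have hnself : inner ℝ n n = (1 : ℝ) := by rw [real_inner_self_eq_norm_sq, hn1, one_pow]
  simp only [hmdef, inner_sub_left, inner_add_left, real_inner_smul_left, hnself] at e1 e2 e3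
  linarith

theorem IsLocallyEnclosedAt.norm_sub_lt {K : Set (Euc d)} (hK : Convex ℝ K) {x u z : Euc d}
    {R η ε : ℝ} (hx : x ∈ K) (hR : 0 < R) (hη : 0 < η) (h : IsLocallyEnclosedAt K x u R η)
    (hε : ε ≤ η ^ 2 / (4 * R)) (hz : z ∈ K) (hzu : -ε ≤ inner ℝ (z - x) u) : ‖z - x‖ < η := by
  by_contra! hc
  have h1 := h.mul_norm_le hK hx hη hz hc
  rw [le_div_iff₀ (by positivity)] at hε
  nlinarith [mul_le_mul_of_nonneg_left hc hη.le, mul_le_mul_of_nonneg_left hzu hR.le,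
    mul_pos hη hη]

theorem exists_local_congruence {K L : Set (Euc d)} (hKcl : IsClosed K) (hK : Convex ℝ K)
    (hKA : CondA K) (hLcl : IsClosed L) (hL : Convex ℝ L) (hLi : (interior L).Nonempty)
    (hLA : CondA L) (H : HasSymmetricIntersections K L) {x u : Euc d} {R η : ℝ} (hx : x ∈ K)
    (hu : ‖u‖ = 1) (hR : 0 < R) (hη : 0 < η) (hxu : IsLocallyEnclosedAt K x u R η) :
    ∃ δ, 0 < δ ∧ ∀ y v, IsSupportedAt L y v → ∀ σ : Euc d ≃ₗᵢ[ℝ] Euc d, IsRotation σ →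
      σ v = -u → ∀ q, ‖q‖ < δ → (x - σ q ∈ K ↔ y + q ∈ L) := by
  have hKsup : IsSupportedAt K x u := ⟨hx, hu, hxu.inner_le hK hx hR hη⟩
  obtain ⟨r, hr, hrK⟩ := exists_inner_ball hKA hKsup
  obtain ⟨q₀, hq₀⟩ := hLi
  obtain ⟨ρ, hρ, hρL⟩ : ∃ ρ, 0 < ρ ∧ closedBall q₀ ρ ⊆ L := by
    obtain ⟨ρ, hρ, h⟩ := Metric.nhds_basis_closedBall.mem_iff.1 (mem_interior_iff_mem_nhds.1 hq₀)
    exact ⟨ρ, hρ, h⟩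
  obtain ⟨η', hη', hη'ρ, hxu'⟩ :
      ∃ η', 0 < η' ∧ η' ≤ ρ / 2 ∧ IsLocallyEnclosedAt K x u R η' :=
    ⟨min η (ρ / 2), lt_min hη (by positivity), min_le_right _ _,
      fun z hz hzx => hxu z hz (hzx.trans (min_le_left _ _))⟩
  obtain ⟨ε, hε, hεr, hερ, hεη, hεη'⟩ :
      ∃ ε, 0 < ε ∧ ε ≤ r ∧ ε ≤ ρ / 4 ∧ ε ≤ η' ^ 2 / (4 * R) ∧ ε ≤ η' := by
    refine ⟨min (min r (ρ / 4)) (min (η' ^ 2 / (4 * R)) η'), ?_, ?_, ?_, ?_, ?_⟩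
    · exact lt_min (lt_min hr (by positivity)) (lt_min (by positivity) hη')
    · exact (min_le_left _ _).trans (min_le_left _ _)
    · exact (min_le_left _ _).trans (min_le_right _ _)
    · exact (min_le_right _ _).trans (min_le_left _ _)
    · exact (min_le_right _ _).trans (min_le_right _ _)
  refine ⟨ε, hε, fun y v hyv σ hσ hσv => ?_⟩
  set a := x - ε • u with ha
  have hballK : closedBall a ε ⊆ K := hrK ε hε hεr
  have hxa : ‖x - a‖ = ε := by simp [ha, norm_smul, hu, abs_of_pos hε]
  set ψ := rotateAndMove σ y a with hψ
  set M := ψ '' L with hMdef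
  have hMcl : IsClosed M := ψ.toHomeomorph.isClosed_image.2 hLcl
  have hM : Convex ℝ M := hL.affine_image (ψ.toAffineEquiv : Euc d →ᵃ[ℝ] Euc d)
  have hMA : CondA M := hLA.image ψ
  have hMb : closedBall (ψ q₀) ρ ⊆ M :=
    (ψ.toIsometryEquiv.image_closedBall q₀ ρ).symm.subset.trans (image_mono hρL)
  have hMi : (interior M).Nonempty :=
    ⟨ψ q₀, interior_mono hMb (ball_subset_interior_closedBall (mem_ball_self hρ))⟩
  have hMmem : ∀ p, p ∈ M ↔ y + σ.symm (p - a) ∈ L := fun p => mem_image_rotateAndMove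
  have haM : a ∈ M := by rw [hMmem]; simpa using hyv.1
  have hMsup : ∀ z ∈ M, 0 ≤ inner ℝ (z - a) u := by
    intro z hz
    have h1 := hyv.2.2 _ ((hMmem z).1 hz)
    rw [add_sub_cancel_left, ← σ.inner_map_map, σ.apply_symm_apply, hσv, inner_neg_right] at h1
    linarith
  have hSsub : ∀ z ∈ K ∩ M, ‖z - x‖ < η' := by
    rintro z ⟨hzK, hzM⟩
    refine hxu'.norm_sub_lt hK hx hR hη' hεη hzK ?_
    have h1 := hMsup z hzM
    have e : z - a = (z - x) + ε • u := by rw [ha]; abel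
    rw [e, inner_add_left, real_inner_smul_left, real_inner_self_eq_norm_sq, hu] at h1
    linarith
  have haK : a ∈ interior K :=
    interior_mono hballK (ball_subset_interior_closedBall (mem_ball_self hε))
  have hcomp : IsCompact (K ∩ M) :=
    (isCompact_closedBall x η').of_isClosed_subset (hKcl.inter hMcl) fun z hz => by
      rw [mem_closedBall, dist_eq_norm]; exact (hSsub z hz).le
  have hSi : (interior (K ∩ M)).Nonempty := by
    have : a ∈ closure (interior M) := by
      rw [hM.closure_interior_eq_closure_of_nonempty_interior hMi]; exact subset_closure haM
    rw [interior_inter]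
    exact mem_closure_iff.1 this _ isOpen_interior haK
  obtain ⟨c, hc⟩ := H ψ (orientationPreserving_rotateAndMove hσ y a) hcomp hSi
  have hS : ∀ z ∈ K ∩ M, (2 : ℝ) • c - z ∈ K ∩ M := by
    intro z hz
    rw [← hc]
    exact ⟨z, hz, rfl⟩
  obtain ⟨w, hwdef⟩ : ∃ w, w = (2 : ℝ) • c - a := ⟨_, rfl⟩
  have haS : a ∈ K ∩ M := ⟨interior_subset haK, haM⟩
  have hwS : w ∈ K ∩ M := hwdef ▸ hS a haS
  have hwi : w ∈ interior M := by
    by_contra hwi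
    have h1 := le_norm_sub_center hMcl hM hMA hρ hMb hS hwS.1 ⟨subset_closure hwS.2, hwi⟩
      (by rwa [hwdef, sub_sub_cancel])
    have h2 : (2 : ℝ) • (w - c) = (w - x) + (x - a) := by
      rw [hwdef]; module
    have h3 : 2 * ‖w - c‖ ≤ ‖w - x‖ + ‖x - a‖ := by
      rw [← Real.norm_of_nonneg (zero_le_two (α := ℝ)), ← norm_smul, h2]
      exact norm_add_le _ _
    linarith [hSsub w hwS]
  have hwx : w = x := by
    obtain ⟨s, hs, hsM⟩ := Metric.isOpen_iff.1 isOpen_interior w hwi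
    have hmax := inner_le_of_local hK (u := u) hwS.1 hs (fun z hz hzw => by
      have h1 := hMsup _ (hS z ⟨hz, interior_subset (hsM (by rwa [mem_ball, dist_eq_norm]))⟩).2
      have e : (2 : ℝ) • c - z - a = -(z - w) := by rw [hwdef]; abel
      rw [e, inner_neg_left] at h1
      linarith) x hx
    have h2 := hxu' w hwS.1 (hSsub w hwS).le
    rw [← neg_sub, inner_neg_left] at hmax
    have h3 : ‖w - x‖ ^ 2 ≤ 0 := by nlinarith
    rw [← sub_eq_zero, ← norm_eq_zero]
    nlinarith [norm_nonneg (w - x)]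
  have h2c : (2 : ℝ) • c = x + a := by rw [← hwx, hwdef]; abel
  have hint : K ∩ ball x ε ⊆ interior M := by
    refine (hK.inter (convex_ball x ε)).isPreconnected.subset_left_of_subset_union
      isOpen_interior hMcl.isOpen_compl
      (disjoint_compl_right.mono_left interior_subset) ?_ ⟨x, ⟨hx, mem_ball_self hε⟩, hwx ▸ hwi⟩
    rintro p ⟨hpK, hpx⟩
    by_contra hcon
    rw [mem_union, not_or, notMem_compl_iff] at hcon
    rw [mem_ball, dist_eq_norm] at hpx
    have h1 := le_norm_sub_center hMcl hM hMA hρ hMb hS hpK ⟨subset_closure hcon.2, hcon.1⟩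
      (interior_mono hballK (ball_subset_interior_closedBall (by
        have e : (2 : ℝ) • c - p - a = -(p - x) := by rw [h2c]; abel
        rwa [mem_ball, dist_eq_norm, e, norm_neg])))
    have h2 : (2 : ℝ) • (p - c) = (p - x) + (p - x) + (x - a) := by
      rw [smul_sub, h2c]; module
    have h3 : 2 * ‖p - c‖ ≤ ‖p - x‖ + ‖p - x‖ + ‖x - a‖ := by
      rw [← Real.norm_of_nonneg (zero_le_two (α := ℝ)), ← norm_smul, h2]
      exact norm_add₃_le
    linarith
  intro q hq
  have hM' : a + σ q ∈ M ↔ y + q ∈ L := by rw [hMmem]; simp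
  rw [← hM']
  constructor
  · intro hp
    have h1 := hS _ ⟨hp, interior_subset (hint ⟨hp, by simpa [dist_eq_norm] using hq⟩)⟩
    rw [h2c] at h1
    convert h1.2 using 1
    abel
  · intro hp
    have h1 := hS _ ⟨hballK (by simpa using hq.le), hp⟩
    rw [h2c] at h1
    convert h1.1 using 1
    abel

end LocalCongruence

section Homogeneity

variable {d : ℕ}

theorem unit_sphere_induction (hd : 2 ≤ d) {P : Euc d → Prop} {η : ℝ} (hη : 0 < η)
    (hstep : ∀ u v, ‖u‖ = 1 → ‖v‖ = 1 → ‖v - u‖ < η → P u → P v)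
    {u₀ : Euc d} (hu₀ : ‖u₀‖ = 1) (h₀ : P u₀) {u : Euc d} (hu : ‖u‖ = 1) : P u := by
  have hrank : 1 < Module.rank ℝ (Euc d) := by
    rw [← Module.finrank_eq_rank, finrank_euclideanSpace_fin]
    exact_mod_cast (by omega : 1 < d)
  have hopen : ∀ Q : Euc d → Prop, IsOpen (⋃ v ∈ {v : Euc d | ‖v‖ = 1 ∧ Q v}, ball v (η / 2)) :=
    fun Q => isOpen_biUnion fun _ _ => isOpen_ball
  have hsub := (isPreconnected_sphere hrank (0 : Euc d) 1).subset_left_of_subset_union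
    (hopen P) (hopen fun v => ¬ P v) ?_ ?_ ?_ (mem_sphere_zero_iff_norm.2 hu)
  · obtain ⟨v, ⟨hv, hPv⟩, hvu⟩ := mem_iUnion₂.1 hsub
    refine hstep v u hv hu ?_ hPv
    rw [← dist_eq_norm]
    exact (mem_ball.1 hvu).trans (by linarith)
  · refine Set.disjoint_left.2 fun p hp hp' => ?_
    obtain ⟨v, ⟨hv, hPv⟩, hvp⟩ := mem_iUnion₂.1 hp
    obtain ⟨v', ⟨hv', hPv'⟩, hvp'⟩ := mem_iUnion₂.1 hp'
    refine hPv' (hstep v v' hv hv' ?_ hPv)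
    rw [← dist_eq_norm]
    rw [mem_ball] at hvp hvp'
    rw [dist_comm] at hvp'
    linarith [dist_triangle v' p v]
  · intro v hv
    rw [mem_sphere_zero_iff_norm] at hv
    by_cases hPv : P v
    · exact Or.inl (mem_biUnion (x := v) ⟨hv, hPv⟩ (mem_ball_self (by positivity)))
    · exact Or.inr (mem_biUnion (x := v) ⟨hv, hPv⟩ (mem_ball_self (by positivity)))
  · exact ⟨u₀, mem_sphere_zero_iff_norm.2 hu₀,
      mem_biUnion (x := u₀) ⟨hu₀, h₀⟩ (mem_ball_self (by positivity))⟩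

theorem IsSupportedAt.exists_near {L : Set (Euc d)} (hLcl : IsClosed L) (hL : Convex ℝ L)
    {y v v' : Euc d} {R η : ℝ} (hR : 0 < R) (hη : 0 < η) (hyv : IsSupportedAt L y v)
    (h : IsLocallyEnclosedAt L y v R η) (hv' : ‖v'‖ = 1) (hvv' : ‖v' - v‖ < η / (2 * R)) :
    ∃ y', IsSupportedAt L y' v' ∧ ‖y' - y‖ < η := by
  obtain ⟨z, ⟨hzL, hzy⟩, hmax⟩ := ((isCompact_closedBall y η).inter_left hLcl).exists_isMaxOn
    ⟨y, hyv.1, mem_closedBall_self hη.le⟩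
    (f := fun p => inner ℝ (p - y) v') (by fun_prop)
  rw [mem_closedBall, dist_eq_norm] at hzy
  have hz0 : 0 ≤ inner ℝ (z - y) v' := by
    simpa using hmax (a := y) ⟨hyv.1, mem_closedBall_self hη.le⟩
  have hlt : ‖z - y‖ < η := by
    refine lt_of_le_of_ne hzy fun heq => ?_
    have h1 := h z hzL hzy
    have h2 := real_inner_le_norm (z - y) (v' - v)
    rw [inner_sub_right] at h2
    rw [lt_div_iff₀ (by positivity)] at hvv'
    rw [heq] at h1 h2
    nlinarith [mul_lt_mul_of_pos_left hvv' hη, mul_le_mul_of_nonneg_left h2 hR.le,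
      mul_nonneg hR.le hz0]
  refine ⟨z, ⟨hzL, hv', ?_⟩, hlt⟩
  refine inner_le_of_local hL hzL (sub_pos.2 hlt) fun p hp hpz => ?_
  have h1 : inner ℝ (p - y) v' ≤ inner ℝ (z - y) v' := hmax (a := p) ⟨hp, by
    rw [mem_closedBall, dist_eq_norm]
    have := norm_sub_le_norm_sub_add_norm_sub p z y
    linarith⟩
  rw [inner_sub_left] at h1 ⊢
  rw [inner_sub_left] at h1
  linarith

/-- A set whose boundary looks the same, at scale `δ`, near all of its boundary points, and which
is uniformly locally enclosed by balls of radius `R`. -/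
structure IsLocallyHomogeneous (L : Set (Euc d)) (R δ : ℝ) : Prop where
  radius_pos : 0 < R
  scale_pos : 0 < δ
  mem_iff : ∀ y v y' v', IsSupportedAt L y v → IsSupportedAt L y' v' →
    ∀ σ : Euc d ≃ₗᵢ[ℝ] Euc d, IsRotation σ → σ v = v' →
      ∀ q, ‖q‖ < δ → (y + q ∈ L ↔ y' + σ q ∈ L)
  enclosed : ∀ y v, IsSupportedAt L y v → IsLocallyEnclosedAt L y v R δ

variable {L : Set (Euc d)} {R δ : ℝ}

theorem IsLocallyHomogeneous.exists_translation (h : IsLocallyHomogeneous L R δ) (hd : 2 ≤ d)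
    (hLcl : IsClosed L) (hL : Convex ℝ L) {σ : Euc d ≃ₗᵢ[ℝ] Euc d} (hσ : IsRotation σ)
    {y₀ y₁ v₀ : Euc d} (h₀ : IsSupportedAt L y₀ v₀) (h₁ : IsSupportedAt L y₁ (σ v₀)) :
    ∃ t, ∀ u, ‖u‖ = 1 → ∃ y, IsSupportedAt L y u ∧ IsSupportedAt L (σ y + t) (σ u) := by
  have hR := h.radius_pos
  have hδ := h.scale_pos
  refine ⟨y₁ - σ y₀, fun u hu => ?_⟩
  generalize ht : y₁ - σ y₀ = t
  refine unit_sphere_induction hd (P := fun u => ∃ y, IsSupportedAt L y u ∧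
    IsSupportedAt L (σ y + t) (σ u)) (div_pos hδ (by positivity : 0 < 2 * R)) ?_ h₀.2.1
    ⟨y₀, h₀, by rwa [← ht, add_sub_cancel]⟩ hu
  rintro u u' - hu' huu' ⟨y, hy, hy'⟩
  obtain ⟨z, hz, hzy⟩ := hy.exists_near hLcl hL hR hδ (h.enclosed y u hy) hu' huu'
  refine ⟨z, hz, ?_⟩
  have hmem : ∀ q, ‖q‖ < δ → (y + q ∈ L ↔ σ y + t + σ q ∈ L) :=
    h.mem_iff y u _ _ hy hy' σ hσ rfl
  have hzL : σ z + t ∈ L := by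
    have := (hmem (z - y) hzy).1 (by rw [add_sub_cancel]; exact hz.1)
    rwa [map_sub, add_right_comm, add_sub_cancel] at this
  refine ⟨hzL, by rw [σ.norm_map, hu'], ?_⟩
  refine inner_le_of_local hL hzL (sub_pos.2 hzy) fun p hp hpz => ?_
  have e1 : p = σ y + t + σ (σ.symm (p - t) - y) := by
    rw [map_sub, σ.apply_symm_apply]; abel
  have e2 : p - (σ z + t) = σ (σ.symm (p - t) - z) := by
    rw [map_sub, σ.apply_symm_apply]; abel
  rw [e2, σ.norm_map] at hpz
  have h2 : σ.symm (p - t) ∈ L := by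
    have h3 : ‖σ.symm (p - t) - y‖ < δ := by
      have := norm_sub_le_norm_sub_add_norm_sub (σ.symm (p - t)) z y
      linarith
    have h4 := (hmem _ h3).2 (by rwa [← e1])
    rwa [add_sub_cancel] at h4
  rw [e2, σ.inner_map_map]
  exact hz.2.2 _ h2

theorem mem_of_forall_inner_le (hLcl : IsClosed L) (hL : Convex ℝ L) (hne : L.Nonempty)
    {z : Euc d} (h : ∀ u, ‖u‖ = 1 → ∃ y ∈ L, inner ℝ (z - y) u ≤ 0) : z ∈ L := by
  by_contra hz
  obtain ⟨f, s, hf, hs⟩ := geometric_hahn_banach_closed_point hL hLcl hz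
  have hf0 : f ≠ 0 := by
    rintro rfl
    obtain ⟨p, hp⟩ := hne
    have := hf p hp
    rw [zero_apply] at this hs
    linarith
  obtain ⟨n, hn, c, hc, hfn⟩ := exists_unit_of_functional f hf0
  obtain ⟨y, hy, hzy⟩ := h n hn
  have h1 := (hf y hy).trans hs
  rw [hfn, hfn] at h1
  rw [inner_sub_left] at hzy
  linarith [lt_of_mul_lt_mul_left h1 hc.le]

theorem IsLocallyHomogeneous.exists_isSupportedAt (h : IsLocallyHomogeneous L R δ) (hd : 2 ≤ d)
    (hLcl : IsClosed L) (hL : Convex ℝ L) {y₀ v₀ : Euc d} (h₀ : IsSupportedAt L y₀ v₀)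
    {u : Euc d} (hu : ‖u‖ = 1) : ∃ y, IsSupportedAt L y u := by
  obtain ⟨t, ht⟩ := h.exists_translation hd hLcl hL (σ := LinearIsometryEquiv.refl ℝ _)
    LinearMap.det_id h₀ h₀
  obtain ⟨y, hy, -⟩ := ht u hu
  exact ⟨y, hy⟩

theorem IsLocallyHomogeneous.isBounded (h : IsLocallyHomogeneous L R δ) (hd : 2 ≤ d)
    (hLcl : IsClosed L) (hL : Convex ℝ L) {y v : Euc d} (hy : IsSupportedAt L y v) :
    Bornology.IsBounded L := by
  have hδ := h.scale_pos
  have hR := h.radius_pos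
  obtain ⟨y', hy'⟩ := h.exists_isSupportedAt hd hLcl hL hy (u := -v) (by rw [norm_neg, hy.2.1])
  refine (Metric.isBounded_closedBall (x := y)
    (r := max δ (2 * R * ‖y - y'‖ / δ))).subset fun z hz => ?_
  rw [mem_closedBall, dist_eq_norm]
  rcases le_total ‖z - y‖ δ with hle | hle
  · exact hle.trans (le_max_left _ _)
  · refine le_trans ?_ (le_max_right _ _)
    have h1 := (h.enclosed y v hy).mul_norm_le hL hy.1 hδ hz hle
    have h2 := hy'.2.2 z hz
    have h3 := real_inner_le_norm (y - y') v
    rw [hy.2.1, mul_one] at h3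
    rw [inner_neg_right] at h2
    rw [le_div_iff₀ hδ]
    rw [inner_sub_left] at h1 h2 h3
    have h4 : inner ℝ y v - inner ℝ z v ≤ ‖y - y'‖ := by linarith
    linarith [mul_le_mul_of_nonneg_left h4 hR.le]

theorem IsLocallyHomogeneous.exists_invariant (h : IsLocallyHomogeneous L R δ) (hd : 2 ≤ d)
    (hLcl : IsClosed L) (hL : Convex ℝ L) {y₀ v₀ : Euc d} (h₀ : IsSupportedAt L y₀ v₀)
    {σ : Euc d ≃ₗᵢ[ℝ] Euc d} (hσ : IsRotation σ) :
    ∃ t, ∀ z, σ z + t ∈ L ↔ z ∈ L := by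
  have hne : L.Nonempty := ⟨y₀, h₀.1⟩
  obtain ⟨y₁, h₁⟩ := h.exists_isSupportedAt hd hLcl hL h₀ (u := σ v₀)
    (by rw [σ.norm_map, h₀.2.1])
  obtain ⟨t, ht⟩ := h.exists_translation hd hLcl hL hσ h₀ h₁
  refine ⟨t, fun z => ⟨fun hz => ?_, fun hz => ?_⟩⟩
  · refine mem_of_forall_inner_le hLcl hL hne fun u hu => ?_
    obtain ⟨y, hy, hy'⟩ := ht u hu
    refine ⟨y, hy.1, ?_⟩
    have := hy'.2.2 _ hz
    rwa [add_sub_add_right_eq_sub, ← map_sub, σ.inner_map_map] at this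
  · refine mem_of_forall_inner_le hLcl hL hne fun u hu => ?_
    obtain ⟨y, hy, hy'⟩ := ht (σ.symm u) (by rw [LinearIsometryEquiv.norm_map, hu])
    refine ⟨_, hy'.1, ?_⟩
    have := hy.2.2 _ hz
    rwa [← σ.inner_map_map, σ.apply_symm_apply, map_sub,
      ← add_sub_add_right_eq_sub _ _ t] at this

end Homogeneity

section Balls

variable {d : ℕ}

theorem nontrivial_of_interior_nonempty (hd : 2 ≤ d) {L : Set (Euc d)}
    (hL : (interior L).Nonempty) : L.Nontrivial := by
  obtain ⟨w, hw, -⟩ := exists_ne_zero_inner_eq_zero hd (0 : Euc d)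
  have : Nontrivial (Euc d) := ⟨w, 0, hw⟩
  obtain ⟨p, hp⟩ := hL
  have : (nhdsWithin p {p}ᶜ).NeBot := Module.punctured_nhds_neBot ℝ (Euc d) p
  exact (infinite_of_mem_nhds p (mem_interior_iff_mem_nhds.1 hp)).nontrivial

theorem eq_closedBall_of_rotation_invariant (hd : 2 ≤ d) {L : Set (Euc d)} (hLcpt : IsCompact L)
    (hL : Convex ℝ L) (hLi : (interior L).Nonempty) {o : Euc d}
    (ho : ∀ σ : Euc d ≃ₗᵢ[ℝ] Euc d, IsRotation σ → ∀ p, o + p ∈ L → o + σ p ∈ L) :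
    ∃ r, 0 < r ∧ L = closedBall o r := by
  obtain ⟨z, hz, hmax⟩ := hLcpt.exists_isMaxOn (hLi.mono interior_subset)
    (f := fun p => dist p o) (by fun_prop)
  have hsub : L ⊆ closedBall o (dist z o) := fun p hp => hmax hp
  have hsph : ∀ p, ‖p‖ = dist z o → o + p ∈ L := by
    intro p hp
    obtain ⟨σ, hσ, hσz⟩ := exists_isRotation_map_eq hd (v := z - o) (u := p)
      (by rw [hp, dist_eq_norm])
    rw [← hσz]
    exact ho σ hσ _ (by rwa [add_sub_cancel])
  have hnt := nontrivial_of_interior_nonempty hd hLi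
  have : Nontrivial (Euc d) := Set.nontrivial_of_nontrivial hnt
  have hr : 0 < dist z o := by
    by_contra! h
    obtain ⟨p, hp, hpo⟩ := hnt.exists_ne o
    exact hpo (dist_le_zero.1 ((hsub hp).trans h))
  refine ⟨dist z o, hr, hsub.antisymm fun p hp => ?_⟩
  rw [← convexHull_sphere_eq_closedBall o hr.le] at hp
  refine convexHull_min (fun q hq => ?_) hL hp
  have := hsph (q - o) (by rwa [← dist_eq_norm])
  rwa [add_sub_cancel] at this

open MeasureTheory in
/-- A bounded set which each rotation leaves invariant up to a translation is invariant under all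
rotations about its barycentre. -/
theorem exists_rotation_invariant {L : Set (Euc d)} (hLcpt : IsCompact L)
    (hLi : (interior L).Nonempty)
    (h : ∀ σ : Euc d ≃ₗᵢ[ℝ] Euc d, IsRotation σ → ∃ t, ∀ z, σ z + t ∈ L ↔ z ∈ L) :
    ∃ o, ∀ σ : Euc d ≃ₗᵢ[ℝ] Euc d, IsRotation σ → ∀ p, o + p ∈ L → o + σ p ∈ L := by
  have hfin : volume L ≠ ⊤ := hLcpt.measure_lt_top.ne
  have hpos : volume L ≠ 0 := (Measure.measure_pos_of_nonempty_interior volume hLi).ne'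
  refine ⟨⨍ x in L, x, fun σ hσ p hp => ?_⟩
  obtain ⟨t, ht⟩ := h σ hσ
  have hint : IntegrableOn (fun x : Euc d => x) L :=
    continuous_id.continuousOn.integrableOn_compact hLcpt
  have : Fact (volume L < ⊤) := ⟨hfin.lt_top⟩
  have : NeZero (volume.restrict L) := ⟨by simpa using hpos⟩
  have hfix : σ (⨍ x in L, x) + t = ⨍ x in L, x := by
    have hmp : MeasurePreserving (fun z => σ z + t) :=
      (measurePreserving_add_right volume t).comp σ.measurePreserving
    have hemb : MeasurableEmbedding (fun z => σ z + t) :=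
      (MeasurableEquiv.addRight t).measurableEmbedding.comp σ.toMeasurableEquiv.measurableEmbedding
    have h1 := hmp.setIntegral_preimage_emb hemb (fun x => x) L
    have h2 : (fun z => σ z + t) ⁻¹' L = L := Set.ext ht
    rw [h2] at h1
    have h3 := integral_add (μ := volume.restrict L) (f := fun x => σ x) (g := fun _ => t)
      (σ.toContinuousLinearEquiv.toContinuousLinearMap.integrable_comp hint)
      (integrable_const t)
    have h4 : ∫ x in L, σ x = σ (∫ x in L, x) :=
      σ.toContinuousLinearEquiv.toContinuousLinearMap.integral_comp_comm hint
    rw [h1, h4, setIntegral_const] at h3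
    rw [setAverage_eq, map_smul]
    nth_rewrite 2 [h3]
    rw [smul_add, inv_smul_smul₀ ((measureReal_ne_zero_iff hfin).2 hpos)]
  have h1 := (ht ((⨍ x in L, x) + p)).2 hp
  rwa [map_add, add_right_comm, hfix] at h1

end Balls

section SymmetricIntersections

variable {d : ℕ}

theorem isLocallyHomogeneous_of_exists_local_congruence (hd : 2 ≤ d) {K L : Set (Euc d)}
    {x u : Euc d} {R η δ : ℝ} (hu : ‖u‖ = 1) (hR : 0 < R) (hη : 0 < η)
    (hxu : IsLocallyEnclosedAt K x u R η) (hδ : 0 < δ)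
    (h : ∀ y v, IsSupportedAt L y v → ∀ σ : Euc d ≃ₗᵢ[ℝ] Euc d, IsRotation σ → σ v = -u →
      ∀ q, ‖q‖ < δ → (x - σ q ∈ K ↔ y + q ∈ L)) :
    IsLocallyHomogeneous L R (min δ η / 2) := by
  have hm : 0 < min δ η := lt_min hδ hη
  have hmδ : min δ η ≤ δ := min_le_left _ _
  have hmη : min δ η ≤ η := min_le_right _ _
  refine ⟨hR, by positivity, fun y v y' v' hy hy' σ hσ hσv q hq => ?_, fun y v hy z hz hzy => ?_⟩
  · obtain ⟨τ, hτ, hτv⟩ := exists_isRotation_map_eq hd (v := v') (u := -u)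
      (by rw [hy'.2.1, norm_neg, hu])
    rw [← h y v hy (σ.trans τ) (hσ.trans hτ) (by rw [LinearIsometryEquiv.trans_apply, hσv, hτv]) q
      (by linarith), ← h y' v' hy' τ hτ hτv (σ q) (by rw [σ.norm_map]; linarith)]
    rfl
  · obtain ⟨τ, hτ, hτv⟩ := exists_isRotation_map_eq hd (v := v) (u := -u)
      (by rw [hy.2.1, norm_neg, hu])
    have h1 := (h y v hy τ hτ hτv (z - y) (by linarith)).2 (by rwa [add_sub_cancel])
    have e : x - τ (z - y) - x = -τ (z - y) := by abel
    have h2 := hxu _ h1 (by rw [e, norm_neg, τ.norm_map]; linarith)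
    rwa [e, norm_neg, τ.norm_map, inner_neg_left, ← inner_neg_right, ← hτv,
      τ.inner_map_map] at h2

/-- If all compact intersections of `K` with congruent copies of `L` are symmetric and `K` is
enclosed at one point by a ball of radius `R`, then `L` is a ball, and it is enclosed at its
boundary points by balls of radius `R`. -/
theorem HasSymmetricIntersections.exists_eq_closedBall (hd : 2 ≤ d) {K L : Set (Euc d)}
    (hKcl : IsClosed K) (hK : Convex ℝ K) (hKA : CondA K) (hLcl : IsClosed L) (hL : Convex ℝ L)
    (hLi : (interior L).Nonempty) (hLne : L ≠ univ) (hLA : CondA L)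
    (H : HasSymmetricIntersections K L) {x u : Euc d} {R η : ℝ} (hx : x ∈ K)
    (hu : ‖u‖ = 1) (hR : 0 < R) (hη : 0 < η) (hxu : IsLocallyEnclosedAt K x u R η) :
    ∃ r, 0 < r ∧ ∃ c, L = closedBall c r ∧ ∃ δ, 0 < δ ∧
      ∀ y v, IsSupportedAt L y v → IsLocallyEnclosedAt L y v R δ := by
  obtain ⟨δ, hδ, h⟩ :=
    exists_local_congruence hKcl hK hKA hLcl hL hLi hLA H hx hu hR hη hxu
  have hhom := isLocallyHomogeneous_of_exists_local_congruence hd hu hR hη hxu hδ h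
  obtain ⟨y, hy⟩ := nonempty_frontier_iff.2 ⟨hLi.mono interior_subset, hLne⟩
  obtain ⟨v, hyv⟩ := _root_.exists_isSupportedAt hLcl hL hLi hy
  have hLcpt := Metric.isCompact_of_isClosed_isBounded hLcl (hhom.isBounded hd hLcl hL hyv)
  obtain ⟨c, hc⟩ := exists_rotation_invariant hLcpt hLi
    fun σ hσ => hhom.exists_invariant hd hLcl hL hyv hσ
  obtain ⟨r, hr, hLr⟩ := eq_closedBall_of_rotation_invariant hd hLcpt hL hLi hc
  exact ⟨r, hr, c, hLr, _, hhom.scale_pos, hhom.enclosed⟩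

end SymmetricIntersections

section ExtremePoints

variable {d : ℕ}

/-- A point outside two compact convex subsets of `K` which is extreme in `K` is outside some
compact convex subset containing both. -/
theorem exists_compact_convex_union {K A B : Set (Euc d)} (hK : Convex ℝ K) {e : Euc d}
    (he : ∀ y ∈ K, ∀ z ∈ K, y ≠ z → e ∉ openSegment ℝ y z)
    (hA : IsCompact A) (hAc : Convex ℝ A) (hAK : A ⊆ K) (heA : e ∉ A)
    (hB : IsCompact B) (hBc : Convex ℝ B) (hBK : B ⊆ K) (heB : e ∉ B) :
    ∃ C, IsCompact C ∧ Convex ℝ C ∧ C ⊆ K ∧ e ∉ C ∧ A ∪ B ⊆ C := by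
  rcases A.eq_empty_or_nonempty with rfl | hAne
  · exact ⟨B, hB, hBc, hBK, heB, by simp⟩
  rcases B.eq_empty_or_nonempty with rfl | hBne
  · exact ⟨A, hA, hAc, hAK, heA, by simp⟩
  refine ⟨convexJoin ℝ A B, ?_, hAc.convexJoin hBc, ?_, ?_,
    union_subset (subset_convexJoin_left hBne) (subset_convexJoin_right hAne)⟩
  · have : convexJoin ℝ A B = (fun p : Euc d × Euc d × ℝ => AffineMap.lineMap p.1 p.2.1 p.2.2) ''
        (A ×ˢ B ×ˢ Icc (0 : ℝ) 1) := by
      ext p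
      simp only [mem_convexJoin, segment_eq_image_lineMap, mem_image, Prod.exists, mem_prod]
      constructor
      · rintro ⟨a, ha, b, hb, t, ht, rfl⟩
        exact ⟨a, b, t, ⟨ha, hb, ht⟩, rfl⟩
      · rintro ⟨a, b, t, ⟨ha, hb, ht⟩, rfl⟩
        exact ⟨a, ha, b, hb, t, ht, rfl⟩
    rw [this]
    refine (hA.prod (hB.prod isCompact_Icc)).image ?_
    simp only [AffineMap.lineMap_apply_module]
    fun_prop
  · exact convexJoin_subset hAK hBK hK
  · intro h
    obtain ⟨a, ha, b, hb, hab⟩ := mem_convexJoin.1 h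
    rw [← insert_endpoints_openSegment] at hab
    rcases hab with rfl | rfl | hab
    · exact heA ha
    · exact heB hb
    · by_cases hne : a = b
      · rw [hne, openSegment_same] at hab
        exact heB (hab ▸ hb)
      · exact he a (hAK ha) b (hBK hb) hne hab

theorem exists_compact_convex_sphere {K : Set (Euc d)} (hKcl : IsClosed K) (hK : Convex ℝ K)
    {e : Euc d} (he : ∀ y ∈ K, ∀ z ∈ K, y ≠ z → e ∉ openSegment ℝ y z) :
    ∃ A, IsCompact A ∧ Convex ℝ A ∧ A ⊆ K ∧ e ∉ A ∧ K ∩ sphere e 1 ⊆ A := by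
  refine ((isCompact_sphere e 1).inter_left hKcl).induction_on
    (p := fun S => ∃ A, IsCompact A ∧ Convex ℝ A ∧ A ⊆ K ∧ e ∉ A ∧ S ⊆ A) ?_ ?_ ?_ ?_
  · exact ⟨∅, isCompact_empty, convex_empty, empty_subset _, notMem_empty _, subset_rfl⟩
  · rintro S T hST ⟨A, h1, h2, h3, h4, h5⟩
    exact ⟨A, h1, h2, h3, h4, hST.trans h5⟩
  · rintro S T ⟨A, hA, hAc, hAK, heA, hSA⟩ ⟨B, hB, hBc, hBK, heB, hTB⟩
    obtain ⟨C, h1, h2, h3, h4, h5⟩ :=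
      exists_compact_convex_union hK he hA hAc hAK heA hB hBc hBK heB
    exact ⟨C, h1, h2, h3, h4, (union_subset_union hSA hTB).trans h5⟩
  · rintro p ⟨-, hpe⟩
    refine ⟨_, inter_mem_nhdsWithin (K ∩ sphere e 1) (closedBall_mem_nhds p one_half_pos),
      K ∩ closedBall p (1 / 2), (isCompact_closedBall p _).inter_left hKcl,
      hK.inter (convex_closedBall p _), inter_subset_left, fun h => ?_,
      inter_subset_inter_left _ inter_subset_left⟩
    rw [mem_sphere, dist_comm] at hpe
    have := mem_closedBall.1 h.2
    rw [hpe] at this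
    norm_num at this

/-- An extreme point of `K` is strictly separated from the points of `K` outside the unit ball
around it. -/
theorem exists_bounded_cap {K : Set (Euc d)} (hKcl : IsClosed K) (hK : Convex ℝ K) {e q : Euc d}
    (heK : e ∈ K) (hqK : q ∈ K) (hqe : e ≠ q)
    (he : ∀ y ∈ K, ∀ z ∈ K, y ≠ z → e ∉ openSegment ℝ y z) :
    ∃ v α, ‖v‖ = 1 ∧ α < inner ℝ e v ∧ ∀ z ∈ K, α ≤ inner ℝ z v → ‖z - e‖ ≤ 1 := by
  obtain ⟨A, hA, hAc, hAK, heA, hSA⟩ := exists_compact_convex_sphere hKcl hK he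
  obtain ⟨C, hC, hCc, -, heC, hAC⟩ := exists_compact_convex_union hK he hA hAc hAK heA
    isCompact_singleton (convex_singleton q) (singleton_subset_iff.2 hqK) hqe
  obtain ⟨f, s, hf, hs⟩ := geometric_hahn_banach_closed_point hCc hC.isClosed heC
  have hf0 : f ≠ 0 := by
    rintro rfl
    have := hf q (hAC (Or.inr rfl))
    rw [zero_apply] at this hs
    linarith
  obtain ⟨v, hv, c, hc, hfv⟩ := exists_unit_of_functional f hf0
  refine ⟨v, s / c, hv, ?_, fun z hz hzv => ?_⟩
  · rwa [div_lt_iff₀' hc, ← hfv]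
  rw [div_le_iff₀' hc, ← hfv] at hzv
  by_contra! hze
  have ht : ‖z - e‖⁻¹ ∈ Icc (0 : ℝ) 1 := ⟨by positivity, inv_le_one_of_one_le₀ hze.le⟩
  have h1 := hf _ (hAC (Or.inl (hSA ⟨hK.add_smul_sub_mem heK hz ht, by
    rw [mem_sphere, dist_eq_norm, add_sub_cancel_left, norm_smul, norm_inv, norm_norm,
      inv_mul_cancel₀ (by positivity)]⟩)))
  rw [map_add, map_smul, map_sub, smul_eq_mul] at h1
  nlinarith [mul_nonneg ht.1 (sub_nonneg.2 hzv), mul_nonneg (sub_nonneg.2 ht.2) (sub_pos.2 hs).le]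

theorem exists_isLocallyEnclosedAt {K : Set (Euc d)} (hKcl : IsClosed K) {e v : Euc d} {α : ℝ}
    (heK : e ∈ K) (hv : ‖v‖ = 1) (hα : α < inner ℝ e v)
    (hcap : ∀ z ∈ K, α ≤ inner ℝ z v → ‖z - e‖ ≤ 1) :
    ∃ x u R η, x ∈ K ∧ ‖u‖ = 1 ∧ 0 < R ∧ 0 < η ∧ IsLocallyEnclosedAt K x u R η := by
  have hTcl : IsClosed (K ∩ {z : Euc d | α ≤ inner ℝ z v}) :=
    hKcl.inter (isClosed_le continuous_const (by fun_prop))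
  have hT : IsCompact (K ∩ {z : Euc d | α ≤ inner ℝ z v}) :=
    (isCompact_closedBall e 1).of_isClosed_subset hTcl fun z hz => by
      rw [mem_closedBall, dist_eq_norm]; exact hcap z hz.1 hz.2
  obtain ⟨β, hβ⟩ : ∃ β, β = inner ℝ e v - α := ⟨_, rfl⟩
  have hβ0 : 0 < β := by linarith
  obtain ⟨p, hp⟩ : ∃ p, p = e - β⁻¹ • v := ⟨_, rfl⟩
  obtain ⟨x, ⟨hxK, hxα⟩, hmax⟩ := hT.exists_isMaxOn ⟨e, heK, hα.le⟩
    (f := fun z => ‖z - p‖) (by fun_prop)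
  have hep : ‖e - p‖ = β⁻¹ := by
    rw [hp, sub_sub_cancel, norm_smul, hv, mul_one, norm_inv, Real.norm_of_nonneg hβ0.le]
  have hle : β⁻¹ ≤ ‖x - p‖ := hep ▸ hmax (a := e) ⟨heK, hα.le⟩
  have hR : 0 < ‖x - p‖ := (inv_pos.2 hβ0).trans_le hle
  have hxv : α + β / 2 ≤ inner ℝ x v := by
    have h1 : ‖x - p‖ ^ 2 = ‖x - e‖ ^ 2 + 2 * (β⁻¹ * inner ℝ (x - e) v) + β⁻¹ ^ 2 := by
      have e1 : x - p = (x - e) + β⁻¹ • v := by rw [hp]; abel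
      rw [e1, norm_add_sq_real, real_inner_smul_right, norm_smul, hv, mul_one, norm_inv,
        Real.norm_of_nonneg hβ0.le]
    have h2 : β⁻¹ ^ 2 ≤ ‖x - p‖ ^ 2 := by gcongr
    have h3 : ‖x - e‖ ^ 2 ≤ 1 := pow_le_one₀ (norm_nonneg _) (hcap x hxK hxα)
    have h4 : 0 ≤ 1 + 2 * (β⁻¹ * inner ℝ (x - e) v) := by linarith
    have h5 := mul_nonneg hβ0.le h4
    rw [mul_add, mul_left_comm β 2, mul_inv_cancel_left₀ hβ0.ne', inner_sub_left] at h5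
    linarith
  refine ⟨x, ‖x - p‖⁻¹ • (x - p), ‖x - p‖, β / 2, hxK, ?_, hR, by positivity,
    fun z hz hzx => ?_⟩
  · rw [norm_smul, norm_inv, norm_norm, inv_mul_cancel₀ hR.ne']
  · have h1 := abs_le.1 (abs_real_inner_le_norm (z - x) v)
    rw [hv, mul_one, inner_sub_left] at h1
    have h2 : ‖z - p‖ ≤ ‖x - p‖ := hmax (a := z) ⟨hz, by
      rw [mem_ofPred_eq]; linarith [h1.1]⟩
    have h3 : ‖z - p‖ ^ 2 ≤ ‖x - p‖ ^ 2 := by gcongr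
    have e1 : z - p = (z - x) + (x - p) := by abel
    rw [e1, norm_add_sq_real] at h3
    rw [real_inner_smul_right, mul_assoc, mul_inv_cancel_left₀ hR.ne']
    linarith

end ExtremePoints

section Comparison

variable {d : ℕ}

theorem isLocallyEnclosedAt_closedBall (c : Euc d) {u : Euc d} {r : ℝ} (hu : ‖u‖ = 1)
    (hr : 0 ≤ r) (η : ℝ) : IsLocallyEnclosedAt (closedBall c r) (c + r • u) u r η := by
  intro z hz _
  rw [mem_closedBall, dist_eq_norm] at hz
  have h1 : ‖z - c‖ ^ 2 ≤ r ^ 2 := by gcongr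
  have e : z - c = (z - (c + r • u)) + r • u := by abel
  rw [e, norm_add_sq_real, real_inner_smul_right, norm_smul, hu, mul_one,
    Real.norm_of_nonneg hr] at h1
  linarith

theorem isSupportedAt_closedBall (c : Euc d) {u : Euc d} {r : ℝ} (hu : ‖u‖ = 1)
    (hr : 0 < r) : IsSupportedAt (closedBall c r) (c + r • u) u := by
  have hmem : c + r • u ∈ closedBall c r := by simp [norm_smul, hu, abs_of_pos hr]
  exact ⟨hmem, hu, (isLocallyEnclosedAt_closedBall c hu hr.le 1).inner_le
    (convex_closedBall c r) hmem hr one_pos⟩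

theorem le_of_isLocallyEnclosedAt_closedBall (hd : 2 ≤ d) {c v : Euc d} {r R η : ℝ}
    (hv : ‖v‖ = 1) (hr : 0 < r) (hη : 0 < η)
    (h : IsLocallyEnclosedAt (closedBall c r) (c + r • v) v R η) : r ≤ R := by
  obtain ⟨w₀, hw₀, hwv₀⟩ := exists_ne_zero_inner_eq_zero hd v
  obtain ⟨w, hw, hwv⟩ : ∃ w : Euc d, ‖w‖ = 1 ∧ inner ℝ w v = 0 :=
    ⟨‖w₀‖⁻¹ • w₀, norm_smul_inv_norm hw₀, by rw [real_inner_smul_left, hwv₀, mul_zero]⟩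
  have hs0 : 0 < min η r := lt_min hη hr
  have hsη : min η r ≤ η := min_le_left _ _
  have hsr : min η r ≤ r := min_le_right _ _
  generalize min η r = s at hs0 hsη hsr
  obtain ⟨α, hα⟩ : ∃ α, α = s ^ 2 / (2 * r) := ⟨_, rfl⟩
  have hα0 : 0 < α := by rw [hα]; positivity
  have hαr : 2 * r * α = s ^ 2 := by rw [hα]; field_simp
  have hαs : α ≤ s := by nlinarith
  obtain ⟨q, hq⟩ : ∃ q, q = √(s ^ 2 - α ^ 2) • w - α • v := ⟨_, rfl⟩
  have hqn : ‖q‖ ^ 2 = s ^ 2 := by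
    rw [hq, norm_sub_sq_real, real_inner_smul_left, real_inner_smul_right, hwv, norm_smul,
      norm_smul, hw, hv, mul_one, mul_one, Real.norm_eq_abs, sq_abs, Real.norm_eq_abs, sq_abs,
      Real.sq_sqrt (by nlinarith)]
    ring
  have hqv : inner ℝ q v = -α := by
    rw [hq, inner_sub_left, real_inner_smul_left, real_inner_smul_left, hwv,
      real_inner_self_eq_norm_sq, hv]
    ring
  have hqs : ‖q‖ = s := (pow_left_inj₀ (norm_nonneg _) hs0.le two_ne_zero).1 hqn
  have hmem : c + r • v + q ∈ closedBall c r := by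
    rw [mem_closedBall, dist_eq_norm]
    refine (pow_le_pow_iff_left₀ (norm_nonneg _) hr.le two_ne_zero).1 ?_
    have e : c + r • v + q - c = q + r • v := by abel
    rw [e, norm_add_sq_real, real_inner_smul_right, hqv, hqn, norm_smul, hv,
      Real.norm_of_nonneg hr.le]
    linarith
  have h1 := h _ hmem (by rw [add_sub_cancel_left]; linarith)
  rw [add_sub_cancel_left, hqn, hqv] at h1
  nlinarith

theorem centrallySymmetric_closedBall_inter (c c' : Euc d) (r : ℝ) :
    CentrallySymmetric (closedBall c r ∩ closedBall c' r) := by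
  refine ⟨(2 : ℝ)⁻¹ • (c + c'), ?_⟩
  rw [smul_inv_smul₀ two_ne_zero]
  have hmem : ∀ z ∈ closedBall c r ∩ closedBall c' r,
      c + c' - z ∈ closedBall c r ∩ closedBall c' r := by
    rintro z ⟨h1, h2⟩
    rw [mem_closedBall, dist_comm, dist_eq_norm] at h1 h2
    constructor
    · rw [mem_closedBall, dist_eq_norm]
      rwa [show c + c' - z - c = c' - z by abel]
    · rw [mem_closedBall, dist_eq_norm]
      rwa [show c + c' - z - c' = c - z by abel]
  refine (image_subset_iff.2 hmem).antisymm fun z hz => ⟨_, hmem z hz, sub_sub_cancel _ _⟩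

theorem exists_congruent_closedBalls (hd : 2 ≤ d) {K L : Set (Euc d)} (hKcl : IsClosed K)
    (hKconv : Convex ℝ K) (hKint : (interior K).Nonempty) (hKne : K ≠ univ)
    (hLcl : IsClosed L) (hLconv : Convex ℝ L) (hLint : (interior L).Nonempty)
    (hLne : L ≠ univ) (hKA : CondA K) (hLA : CondA L) (hext : HasExtremePoint K)
    (HKL : HasSymmetricIntersections K L) (HLK : HasSymmetricIntersections L K) :
    ∃ r : ℝ, 0 < r ∧ ∃ c c' : Euc d, K = closedBall c r ∧ L = closedBall c' r := by
  obtain ⟨e, heK, he⟩ := hext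
  obtain ⟨n, hn, -⟩ := exists_ne_zero_inner_eq_zero hd (0 : Euc d)
  have hu := norm_smul_inv_norm (𝕜 := ℝ) hn
  generalize ‖n‖⁻¹ • n = u at hu
  obtain ⟨q, hqK, hqe⟩ := (nontrivial_of_interior_nonempty hd hKint).exists_ne e
  obtain ⟨v, α, hv, hα, hcap⟩ := exists_bounded_cap hKcl hKconv heK hqK hqe.symm he
  obtain ⟨x, n, R, η, hx, hn, hR, hη, hxn⟩ := exists_isLocallyEnclosedAt hKcl heK hv hα hcap
  obtain ⟨r', hr', c', rfl, -⟩ := HKL.exists_eq_closedBall hd hKcl hKconv hKA hLcl hLconv hLint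
    hLne hLA hx hn hR hη hxn
  obtain ⟨r, hr, c, rfl, δ, hδ, hK⟩ := HLK.exists_eq_closedBall hd hLcl hLconv hLA hKcl hKconv
    hKint hKne hKA (isSupportedAt_closedBall c' hu hr').1 hu hr' one_pos
    (isLocallyEnclosedAt_closedBall c' hu hr'.le 1)
  obtain ⟨-, -, -, -, δ', hδ', hL⟩ := HKL.exists_eq_closedBall hd hKcl hKconv hKA hLcl hLconv
    hLint hLne hLA (isSupportedAt_closedBall c hu hr).1 hu hr one_pos
    (isLocallyEnclosedAt_closedBall c hu hr.le 1)
  have hle := le_of_isLocallyEnclosedAt_closedBall hd hu hr hδ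
    (hK _ _ (isSupportedAt_closedBall c hu hr))
  have hge := le_of_isLocallyEnclosedAt_closedBall hd hu hr' hδ'
    (hL _ _ (isSupportedAt_closedBall c' hu hr'))
  exact ⟨r, hr, c, c', rfl, by rw [hle.antisymm hge]⟩

end Comparison

/-- Theorem 3 (Euclidean case): all compact intersections with nonempty interior of
congruent copies are centrally symmetric iff `K` and `L` are congruent balls. -/
theorem compact_intersections_centrally_symmetric_iff_congruent_balls
    (d : ℕ) (hd : 2 ≤ d) (K L : Set (Euc d))
    (hKcl : IsClosed K) (hKconv : Convex ℝ K) (hKint : (interior K).Nonempty)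
    (hKne : K ≠ univ)
    (hLcl : IsClosed L) (hLconv : Convex ℝ L) (hLint : (interior L).Nonempty)
    (hLne : L ≠ univ)
    (hKA : CondA K) (hLA : CondA L)
    (hext : HasExtremePoint K ∨ HasExtremePoint L) :
    (∀ φ ψ : Euc d ≃ᵃⁱ[ℝ] Euc d,
        OrientationPreserving φ → OrientationPreserving ψ →
        IsCompact (φ '' K ∩ ψ '' L) → (interior (φ '' K ∩ ψ '' L)).Nonempty →
        CentrallySymmetric (φ '' K ∩ ψ '' L)) ↔
    (∃ r : ℝ, 0 < r ∧ ∃ c c' : Euc d, K = closedBall c r ∧ L = closedBall c' r) := by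
  constructor
  · intro H
    have hrefl : OrientationPreserving (AffineIsometryEquiv.refl ℝ (Euc d)) := LinearMap.det_id
    have HKL : HasSymmetricIntersections K L := fun ψ hψ hc hi => by
      simpa using H (AffineIsometryEquiv.refl ℝ _) ψ hrefl hψ (by simpa using hc)
        (by simpa using hi)
    have HLK : HasSymmetricIntersections L K := fun φ hφ hc hi => by
      rw [inter_comm] at hc hi ⊢
      simpa using H φ (AffineIsometryEquiv.refl ℝ _) hφ hrefl (by simpa using hc)
        (by simpa using hi)
    rcases hext with hext | hext
    · exact exists_congruent_closedBalls hd hKcl hKconv hKint hKne hLcl hLconv hLint hLne hKA hLA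
        hext HKL HLK
    · obtain ⟨r, hr, c, c', hL, hK⟩ := exists_congruent_closedBalls hd hLcl hLconv hLint hLne hKcl
        hKconv hKint hKne hLA hKA hext HLK HKL
      exact ⟨r, hr, c', c, hK, hL⟩
  · rintro ⟨r, -, c, c', rfl, rfl⟩ φ ψ - - - -
    have h : ∀ (χ : Euc d ≃ᵃⁱ[ℝ] Euc d) (a : Euc d),
        χ '' closedBall a r = closedBall (χ a) r :=
      fun χ a => χ.toIsometryEquiv.image_closedBall a r
    rw [h, h]
    exact centrallySymmetric_closedBall_inter _ _ _
end
end

section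
/- Let d ≥ 2 and let K, L ⊆ ℝ^d be closed convex sets with nonempty interior, with K ≠ ℝ^d and L ≠ ℝ^d. Assume K and L are smooth (every point of the frontier has a unique supporting hyperplane) and that K and L have a supporting sphere at every boundary point, i.e. for every x in the frontier of K there exist a point c and R > 0 with dist(x, c) = R and K contained in the closed ball of radius R about c, and likewise for L. Then the following are equivalent: (1) for all orientation-preserving surjective isometries φ, ψ of ℝ^d, the closed convex hull of φ(K) ∪ ψ(L) is centrally symmetric; (2) K and L are congruent balls, i.e. there exist r > 0 and points c, c′ with K the closed ball of radius r about c and L the closed ball of radius r about c′. -/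
open Metric Set

noncomputable section

/-- `f` is a unit-norm functional supporting `K` at `x` (so `{y | f y = f x}` is a
supporting hyperplane of `K` through `x`). -/
def IsUnitSupportFunctional {d : ℕ} (K : Set (Euc d)) (x : Euc d) (f : Euc d →L[ℝ] ℝ) : Prop :=
  ‖f‖ = 1 ∧ ∀ y ∈ K, f y ≤ f x

/-- `K` is smooth: at every frontier point there is exactly one supporting hyperplane,
i.e. exactly one unit-norm support functional. -/
def SmoothBody {d : ℕ} (K : Set (Euc d)) : Prop :=
  ∀ x ∈ frontier K, ∃! f : Euc d →L[ℝ] ℝ, IsUnitSupportFunctional K x f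

/-- `K` has a supporting sphere at every boundary point: a sphere through the boundary
point bounding a closed ball containing `K`. -/
def SupportSpheres {d : ℕ} (K : Set (Euc d)) : Prop :=
  ∀ x ∈ frontier K, ∃ c : Euc d, ∃ R : ℝ, 0 < R ∧ dist x c = R ∧ K ⊆ closedBall c R

open scoped InnerProductSpace

/-- The support function of a set. -/
def supportFun {E : Type*} [NormedAddCommGroup E] [InnerProductSpace ℝ E] (S : Set E) (u : E) : ℝ :=
  sSup ((fun x => ⟪x, u⟫_ℝ) '' S)

section SupportFun

variable {E : Type*} [NormedAddCommGroup E] [InnerProductSpace ℝ E]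

theorem supportFun_le_iff {S : Set E} (hb : Bornology.IsBounded S) (hne : S.Nonempty) (u : E)
    (a : ℝ) : supportFun S u ≤ a ↔ ∀ x ∈ S, ⟪x, u⟫_ℝ ≤ a := by
  obtain ⟨R, hR⟩ := hb.exists_norm_le
  have hbdd : BddAbove ((fun x => ⟪x, u⟫_ℝ) '' S) := by
    refine ⟨R * ‖u‖, ?_⟩
    rintro _ ⟨x, hx, rfl⟩
    exact (real_inner_le_norm x u).trans (by gcongr; exact hR x hx)
  rw [supportFun, csSup_le_iff hbdd (hne.image _)]
  simp

theorem inner_le_supportFun {S : Set E} (hb : Bornology.IsBounded S) {x : E} (hx : x ∈ S) (u : E) :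
    ⟪x, u⟫_ℝ ≤ supportFun S u :=
  (supportFun_le_iff hb ⟨x, hx⟩ u _).1 le_rfl x hx

theorem abs_supportFun_le {S : Set E} {R : ℝ} (hR : ∀ x ∈ S, ‖x‖ ≤ R) (hne : S.Nonempty) (u : E) :
    |supportFun S u| ≤ R * ‖u‖ := by
  have hb : Bornology.IsBounded S := isBounded_iff_forall_norm_le.2 ⟨R, hR⟩
  rw [abs_le]
  constructor
  · obtain ⟨x, hx⟩ := hne
    have h1 := inner_le_supportFun hb hx u
    have h2 := neg_le_of_abs_le (abs_real_inner_le_norm x u)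
    have h3 : ‖x‖ * ‖u‖ ≤ R * ‖u‖ := by gcongr; exact hR x hx
    linarith
  · rw [supportFun_le_iff hb hne]
    intro x hx
    exact (real_inner_le_norm x u).trans (by gcongr; exact hR x hx)

theorem supportFun_closure_convexHull_union {S T : Set E} (hS : Bornology.IsBounded S)
    (hSne : S.Nonempty) (hT : Bornology.IsBounded T) (hTne : T.Nonempty) (u : E) :
    supportFun (closure (convexHull ℝ (S ∪ T))) u = max (supportFun S u) (supportFun T u) := by
  refine eq_of_forall_ge_iff fun a => ?_
  rw [supportFun_le_iff (isBounded_convexHull.2 (hS.union hT)).closure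
    (hSne.inl.convexHull.closure), max_le_iff, supportFun_le_iff hS hSne, supportFun_le_iff hT hTne]
  constructor
  · intro h
    have h' : ∀ x ∈ S ∪ T, ⟪x, u⟫_ℝ ≤ a := fun x hx =>
      h x (subset_closure (subset_convexHull ℝ _ hx))
    exact ⟨fun x hx => h' x (Or.inl hx), fun x hx => h' x (Or.inr hx)⟩
  · rintro ⟨h1, h2⟩
    have hconv : Convex ℝ {x : E | ⟪x, u⟫_ℝ ≤ a} :=
      convex_halfSpace_le ⟨fun x y => inner_add_left x y u,
        fun c x => real_inner_smul_left x u c⟩ a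
    have hcl : IsClosed {x : E | ⟪x, u⟫_ℝ ≤ a} := isClosed_le (by fun_prop) (by fun_prop)
    exact closure_minimal (convexHull_min (union_subset h1 h2) hconv) hcl

theorem supportFun_image_add {S : Set E} (hS : Bornology.IsBounded S) (hne : S.Nonempty) (v u : E) :
    supportFun ((fun x => v + x) '' S) u = ⟪v, u⟫_ℝ + supportFun S u := by
  refine eq_of_forall_ge_iff fun a => ?_
  rw [supportFun_le_iff ((isometry_add_left v).lipschitz.isBounded_image hS) (hne.image _),
    add_comm, ← le_sub_iff_add_le, supportFun_le_iff hS hne]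
  simp only [forall_mem_image, inner_add_left, le_sub_iff_add_le']

theorem supportFun_image_sub {S : Set E} (hS : Bornology.IsBounded S) (hne : S.Nonempty) (v u : E) :
    supportFun ((fun x => v - x) '' S) u = ⟪v, u⟫_ℝ + supportFun S (-u) := by
  refine eq_of_forall_ge_iff fun a => ?_
  have hb : Bornology.IsBounded ((fun x => v - x) '' S) :=
    (Isometry.of_dist_eq fun x y => dist_sub_left v x y).lipschitz.isBounded_image hS
  rw [supportFun_le_iff hb (hne.image _),
    add_comm, ← le_sub_iff_add_le, supportFun_le_iff hS hne]
  simp only [forall_mem_image, inner_sub_left, inner_neg_right]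
  refine forall₂_congr fun x _ => ?_
  constructor <;> intro h <;> linarith

theorem subset_of_supportFun_le [CompleteSpace E] {S T : Set E} (hS : Bornology.IsBounded S)
    (hT : Bornology.IsBounded T) (hTne : T.Nonempty) (hTc : Convex ℝ T) (hTcl : IsClosed T)
    (h : ∀ u, supportFun S u ≤ supportFun T u) : S ⊆ T := by
  intro x hx
  by_contra hxT
  obtain ⟨f, a, hf, ha⟩ := geometric_hahn_banach_closed_point hTc hTcl hxT
  obtain ⟨u, rfl⟩ := (InnerProductSpace.toDual ℝ E).surjective f
  simp only [InnerProductSpace.toDual_apply_apply] at hf ha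
  have h1 : supportFun T u ≤ a := (supportFun_le_iff hT hTne u a).2 fun y hy => by
    rw [real_inner_comm]; exact (hf y hy).le
  have h2 := inner_le_supportFun hS hx u
  rw [real_inner_comm] at h2
  linarith [h u]

theorem eq_of_supportFun_eq [CompleteSpace E] {S T : Set E} (hS : Bornology.IsBounded S)
    (hSne : S.Nonempty) (hSc : Convex ℝ S) (hScl : IsClosed S)
    (hT : Bornology.IsBounded T) (hTne : T.Nonempty) (hTc : Convex ℝ T) (hTcl : IsClosed T)
    (h : ∀ u, supportFun S u = supportFun T u) : S = T :=
  (subset_of_supportFun_le hS hT hTne hTc hTcl fun u => (h u).le).antisymm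
    (subset_of_supportFun_le hT hS hSne hSc hScl fun u => (h u).ge)

theorem eq_zero_of_inner_eq_zero_of_isOpen {U : Set E} (hU : IsOpen U) {x w : E} (hx : x ∈ U)
    (h : ∀ u ∈ U, ⟪w, u⟫_ℝ = 0) : w = 0 := by
  have hcont : Continuous fun ε : ℝ => x + ε • w := by fun_prop
  have hev : ∀ᶠ ε : ℝ in nhds 0, x + ε • w ∈ U :=
    hcont.continuousAt.eventually_mem (by simpa using hU.mem_nhds hx)
  obtain ⟨ε, hε, hε0⟩ := ((hev.filter_mono nhdsWithin_le_nhds).and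
    (self_mem_nhdsWithin (s := Ioi (0 : ℝ)))).exists
  have h1 := h _ hε
  rw [inner_add_right, h x hx, inner_smul_right, zero_add] at h1
  exact inner_self_eq_zero.1 ((mul_eq_zero.1 h1).resolve_left (ne_of_gt hε0))

end SupportFun

section FiniteDimensional

variable {E : Type*} [NormedAddCommGroup E] [InnerProductSpace ℝ E] [FiniteDimensional ℝ E]

theorem exists_ne_zero_inner_eq_zero_s4 (hE : 2 ≤ Module.finrank ℝ E) (x : E) :
    ∃ y : E, y ≠ 0 ∧ ⟪x, y⟫_ℝ = 0 := by
  have h : (ℝ ∙ x)ᗮ ≠ ⊥ := by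
    intro h
    have h1 := Submodule.finrank_add_finrank_orthogonal (ℝ ∙ x)
    have h2 := finrank_span_le_card (R := ℝ) ({x} : Set E)
    rw [h, finrank_bot] at h1
    simp only [toFinset_singleton, Finset.card_singleton] at h2
    omega
  obtain ⟨y, hy, hy0⟩ := Submodule.exists_mem_ne_zero_of_ne_bot h
  exact ⟨y, hy0, Submodule.mem_orthogonal_singleton_iff_inner_right.1 hy⟩

theorem det_reflection_orthogonal_singleton_s4 {x : E} (hx : x ≠ 0) :
    LinearMap.det ((ℝ ∙ x)ᗮ.reflection.toLinearEquiv : E →ₗ[ℝ] E) = -1 := by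
  rw [Submodule.det_reflection, Submodule.orthogonal_orthogonal, finrank_span_singleton hx, pow_one]

theorem exists_linearIsometryEquiv_det_eq_one_apply_eq (hE : 2 ≤ Module.finrank ℝ E) {x y : E}
    (h : ‖x‖ = ‖y‖) :
    ∃ A : E ≃ₗᵢ[ℝ] E, LinearMap.det (A.toLinearEquiv : E →ₗ[ℝ] E) = 1 ∧ A x = y := by
  rcases eq_or_ne x y with rfl | hxy
  · exact ⟨LinearIsometryEquiv.refl ℝ E, LinearMap.det_id, rfl⟩
  obtain ⟨z, hz, hxz⟩ := exists_ne_zero_inner_eq_zero_s4 hE x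
  refine ⟨(ℝ ∙ z)ᗮ.reflection.trans (ℝ ∙ (x - y))ᗮ.reflection, ?_, ?_⟩
  · have : (((ℝ ∙ z)ᗮ.reflection.trans (ℝ ∙ (x - y))ᗮ.reflection).toLinearEquiv : E →ₗ[ℝ] E) =
        ((ℝ ∙ (x - y))ᗮ.reflection.toLinearEquiv : E →ₗ[ℝ] E) ∘ₗ
          ((ℝ ∙ z)ᗮ.reflection.toLinearEquiv : E →ₗ[ℝ] E) := rfl
    rw [this, LinearMap.det_comp, det_reflection_orthogonal_singleton_s4 hz,
      det_reflection_orthogonal_singleton_s4 (sub_ne_zero.2 hxy)]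
    norm_num
  · rw [LinearIsometryEquiv.trans_apply,
      Submodule.reflection_mem_subspace_eq_self (K := (ℝ ∙ z)ᗮ) (x := x),
      Submodule.reflection_sub h]
    rw [Submodule.mem_orthogonal_singleton_iff_inner_right, real_inner_comm]
    exact hxz

theorem exists_inner_of_forall_halfSpace (hE : 2 ≤ Module.finrank ℝ E) {g : E → ℝ} (hg0 : g 0 = 0)
    (hg : ∀ v : E, v ≠ 0 → ∃ w : E, ∀ u, 0 < ⟪v, u⟫_ℝ → g u = ⟪w, u⟫_ℝ) :
    ∃ w : E, ∀ u, g u = ⟪w, u⟫_ℝ := by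
  choose! W hW using hg
  have hinter : ∀ v v' : E, v ≠ 0 → v' ≠ 0 → 0 ≤ ⟪v, v'⟫_ℝ → W v = W v' := by
    intro v v' hv hv' h
    have hU : IsOpen {u : E | 0 < ⟪v, u⟫_ℝ ∧ 0 < ⟪v', u⟫_ℝ} :=
      (isOpen_lt (f := fun _ => (0 : ℝ)) (g := fun u => ⟪v, u⟫_ℝ) (by fun_prop) (by fun_prop)).inter
        (isOpen_lt (f := fun _ => (0 : ℝ)) (g := fun u => ⟪v', u⟫_ℝ) (by fun_prop) (by fun_prop))
    have hx : v + v' ∈ {u : E | 0 < ⟪v, u⟫_ℝ ∧ 0 < ⟪v', u⟫_ℝ} := by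
      have h1 := real_inner_self_pos.2 hv
      have h2 := real_inner_self_pos.2 hv'
      have h3 := real_inner_comm v v'
      simp only [mem_ofPred_eq, inner_add_right]
      constructor <;> linarith
    refine sub_eq_zero.1 (eq_zero_of_inner_eq_zero_of_isOpen hU hx fun u hu => ?_)
    rw [inner_sub_left, ← hW v hv u hu.1, ← hW v' hv' u hu.2, sub_self]
  obtain ⟨e, he, -⟩ := exists_ne_zero_inner_eq_zero_s4 hE 0
  obtain ⟨f, hf, hef⟩ := exists_ne_zero_inner_eq_zero_s4 hE e
  have hconst : ∀ v : E, v ≠ 0 → W v = W e := by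
    intro v hv
    rcases le_total 0 ⟪v, f⟫_ℝ with h | h
    · rw [hinter v f hv hf h, hinter e f he hf hef.ge]
    · have hf' : -f ≠ 0 := neg_ne_zero.2 hf
      rw [hinter v (-f) hv hf' (by rw [inner_neg_right]; linarith),
        hinter e (-f) he hf' (by rw [inner_neg_right, hef, neg_zero])]
  refine ⟨W e, fun u => ?_⟩
  rcases eq_or_ne u 0 with rfl | hu
  · rw [hg0, inner_zero_right]
  · rw [← hconst u hu]
    exact hW u hu u (real_inner_self_pos.2 hu)

theorem exists_inner_of_forall_cone (hE : 2 ≤ Module.finrank ℝ E) {g : E → ℝ} (hg0 : g 0 = 0)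
    {C : ℝ} (hC : 0 ≤ C)
    (hg : ∀ v : E, ∃ w : E, ∀ u, C * ‖u‖ < ⟪v, u⟫_ℝ → g u = ⟪w, u⟫_ℝ) :
    ∃ w : E, ∀ u, g u = ⟪w, u⟫_ℝ := by
  choose W hW using hg
  refine exists_inner_of_forall_halfSpace hE hg0 fun v hv => ?_
  have hvpos := norm_pos_iff.2 hv
  set s : ℝ := C / ‖v‖ + 1
  have hs : 0 < s := by positivity
  refine ⟨W (s • v), fun u hu => ?_⟩
  set t : ℝ := s + C * ‖u‖ / ⟪v, u⟫_ℝ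
  have hst : s ≤ t := le_add_of_nonneg_right (by positivity)
  have hU : IsOpen {x : E | C * ‖x‖ < ⟪s • v, x⟫_ℝ} := isOpen_lt (by fun_prop) (by fun_prop)
  have hvU : v ∈ {x : E | C * ‖x‖ < ⟪s • v, x⟫_ℝ} := by
    rw [mem_ofPred_eq, real_inner_smul_left, real_inner_self_eq_norm_sq]
    have : s * ‖v‖ ^ 2 = C * ‖v‖ + ‖v‖ ^ 2 := by simp only [s]; field_simp
    rw [this]
    exact lt_add_of_pos_right _ (by positivity)
  have hWt : W (t • v) = W (s • v) := by
    refine sub_eq_zero.1 (eq_zero_of_inner_eq_zero_of_isOpen hU hvU fun x hx => ?_)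
    have hx' : C * ‖x‖ < ⟪t • v, x⟫_ℝ := by
      rw [mem_ofPred_eq, real_inner_smul_left] at hx
      rw [real_inner_smul_left]
      have hvx : 0 ≤ ⟪v, x⟫_ℝ := (pos_of_mul_pos_right
        ((mul_nonneg hC (norm_nonneg x)).trans_lt hx) hs.le).le
      exact hx.trans_le (by gcongr)
    rw [inner_sub_left, ← hW _ x hx, ← hW _ x hx', sub_self]
  rw [← hWt]
  refine hW _ u ?_
  rw [real_inner_smul_left]
  have : t * ⟪v, u⟫_ℝ = C * ‖u‖ + s * ⟪v, u⟫_ℝ := by simp only [t]; field_simp; ring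
  rw [this]
  exact lt_add_of_pos_right _ (by positivity)

theorem exists_supportFun_sub_eq_inner (hE : 2 ≤ Module.finrank ℝ E) {K L : Set E}
    (hK : Bornology.IsBounded K) (hKne : K.Nonempty) (hL : Bornology.IsBounded L)
    (hLne : L.Nonempty)
    (hsymm : ∀ v : E, ∃ c : E,
      (fun x => (2 : ℝ) • c - x) '' closure (convexHull ℝ (K ∪ (fun x => v + x) '' L)) =
        closure (convexHull ℝ (K ∪ (fun x => v + x) '' L))) :
    ∃ w : E, ∀ u, supportFun L u - supportFun K (-u) = ⟪w, u⟫_ℝ := by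
  obtain ⟨R, hR0, hR⟩ := (hK.union hL).exists_pos_norm_le
  have hKR := abs_supportFun_le (fun x hx => hR x (Or.inl hx)) hKne
  have hLR := abs_supportFun_le (fun x hx => hR x (Or.inr hx)) hLne
  refine exists_inner_of_forall_cone (g := fun u => supportFun L u - supportFun K (-u))
    (C := 2 * R) hE ?_ (by positivity) fun v => ?_
  · have h1 := hKR 0
    have h2 := hLR 0
    rw [norm_zero, mul_zero, abs_nonpos_iff] at h1 h2
    simp [h1, h2]
  obtain ⟨c, hc⟩ := hsymm v
  have hvL : Bornology.IsBounded ((fun x => v + x) '' L) :=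
    (isometry_add_left v).lipschitz.isBounded_image hL
  have hvLne : ((fun x => v + x) '' L).Nonempty := hLne.image _
  refine ⟨(2 : ℝ) • c - v, fun u hu => ?_⟩
  have hM := congrArg (fun S => supportFun S u) hc
  rw [supportFun_image_sub (isBounded_convexHull.2 (hK.union hvL)).closure
    hKne.inl.convexHull.closure, supportFun_closure_convexHull_union hK hKne hvL hvLne,
    supportFun_closure_convexHull_union hK hKne hvL hvLne,
    supportFun_image_add hL hLne, supportFun_image_add hL hLne, inner_neg_right] at hM
  have h1 := abs_le.1 (hKR u)
  have h2 := abs_le.1 (hKR (-u))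
  have h3 := abs_le.1 (hLR u)
  have h4 := abs_le.1 (hLR (-u))
  rw [norm_neg] at h2 h4
  rw [max_eq_left (by linarith), max_eq_right (by linarith)] at hM
  rw [inner_sub_left]
  linarith

open MeasureTheory in
/-- The centroid of a compact set with nonempty interior is fixed by its symmetries. -/
theorem setAverage_fixed_of_image_eq [MeasurableSpace E] [BorelSpace E] {L : Set E}
    (hL : IsCompact L) (hint : (interior L).Nonempty) (A : E ≃ₗᵢ[ℝ] E) (w : E)
    (h : (fun x => A x - w) '' L = L) :
    A (⨍ x in L, x) - w = ⨍ x in L, x := by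
  have hpos : 0 < volume.real L := by
    rw [measureReal_def, ENNReal.toReal_pos_iff]
    exact ⟨(isOpen_interior.measure_pos volume hint).trans_le (measure_mono interior_subset),
      hL.measure_lt_top⟩
  have hT : MeasurePreserving (fun x => A x - w) volume volume :=
    (measurePreserving_sub_right volume w).comp A.measurePreserving
  have hemb : MeasurableEmbedding (fun x => A x - w) :=
    ((Homeomorph.subRight w).measurableEmbedding).comp A.toHomeomorph.measurableEmbedding
  have hpre : (fun x => A x - w) ⁻¹' L = L := by
    conv_lhs => rw [← h]
    exact preimage_image_eq _ hemb.injective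
  have hi : IntegrableOn (fun x : E => x) L := continuousOn_id.integrableOn_compact hL
  have hAi : IntegrableOn (fun x : E => A x) L := A.continuous.continuousOn.integrableOn_compact hL
  have key := hT.setIntegral_preimage_emb hemb (fun x => x) L
  rw [hpre, integral_sub hAi (integrableOn_const hL.measure_lt_top.ne), setIntegral_const] at key
  have hA : ∫ x in L, A x = A (∫ x in L, x) :=
    (A.toContinuousLinearEquiv : E →L[ℝ] E).integral_comp_comm hi
  rw [setAverage_eq, map_smul, ← hA, ← key, smul_sub, inv_smul_smul₀ hpos.ne']

theorem eq_closedBall_of_rotation_invariant_s4 (hE : 2 ≤ Module.finrank ℝ E) {L : Set E}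
    (hL : IsCompact L) (hLc : Convex ℝ L) (hint : (interior L).Nonempty) (p : E)
    (h : ∀ A : E ≃ₗᵢ[ℝ] E, LinearMap.det (A.toLinearEquiv : E →ₗ[ℝ] E) = 1 →
      ∀ x ∈ L, p + A (x - p) ∈ L) :
    ∃ r : ℝ, 0 < r ∧ L = closedBall p r := by
  have : Nontrivial E := Module.nontrivial_of_finrank_pos (R := ℝ) (by omega)
  obtain ⟨x, hx, hmax⟩ := hL.exists_isMaxOn (hint.mono interior_subset)
    (f := fun x => dist x p) (by fun_prop)
  have hsub : L ⊆ closedBall p (dist x p) := fun y hy => hmax hy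
  refine ⟨dist x p, ?_, hsub.antisymm ?_⟩
  · refine dist_nonneg.lt_of_ne fun h0 => ?_
    rw [← h0, closedBall_zero] at hsub
    obtain ⟨y, hy⟩ := hint
    simpa using interior_mono hsub hy
  · rw [← convexHull_sphere_eq_closedBall p dist_nonneg]
    refine convexHull_min (fun y hy => ?_) hLc
    have hxy : ‖x - p‖ = ‖y - p‖ := by
      rw [← dist_eq_norm, ← dist_eq_norm]; exact (mem_sphere.1 hy).symm
    obtain ⟨A, hA, hAx⟩ := exists_linearIsometryEquiv_det_eq_one_apply_eq hE hxy
    simpa [hAx] using h A hA x hx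

end FiniteDimensional

theorem SupportSpheres.isBounded {d : ℕ} {K : Set (Euc d)} (h : SupportSpheres K)
    (hne : K.Nonempty) (hK : K ≠ univ) : Bornology.IsBounded K := by
  obtain ⟨x, hx⟩ := nonempty_frontier_iff.2 ⟨hne, hK⟩
  obtain ⟨c, R, -, -, hR⟩ := h x hx
  exact isBounded_closedBall.subset hR

theorem image_closedBall_affineIsometryEquiv {d : ℕ} (φ : Euc d ≃ᵃⁱ[ℝ] Euc d) (c : Euc d) (r : ℝ) :
    φ '' closedBall c r = closedBall (φ c) r :=
  φ.toIsometryEquiv.image_closedBall c r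

theorem centrallySymmetric_closure_convexHull_union_closedBall {d : ℕ} (a b : Euc d) (r : ℝ) :
    CentrallySymmetric (closure (convexHull ℝ (closedBall a r ∪ closedBall b r))) := by
  let f := AffineIsometryEquiv.pointReflection ℝ (midpoint ℝ a b)
  have hf : (fun x => (2 : ℝ) • midpoint ℝ a b - x) = f := by
    ext1 x
    simp only [f, AffineIsometryEquiv.pointReflection_apply, vsub_eq_sub, vadd_eq_add, two_smul]
    abel
  have hconv : f '' convexHull ℝ (closedBall a r ∪ closedBall b r) =
      convexHull ℝ (f '' (closedBall a r ∪ closedBall b r)) :=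
    f.toAffineEquiv.toAffineMap.image_convexHull _
  have ha : f a = b := by simp [f]
  have hb : f b = a := by simp [f]
  refine ⟨midpoint ℝ a b, ?_⟩
  rw [hf, show f '' closure _ = _ from f.toHomeomorph.image_closure _]
  change closure (f '' _) = _
  rw [hconv, image_union, image_closedBall_affineIsometryEquiv,
    image_closedBall_affineIsometryEquiv, ha, hb, union_comm]

/-- Theorem 4 (Euclidean case): all closed convex hulls of unions of congruent copies
are centrally symmetric iff `K` and `L` are congruent balls. -/
theorem convex_hulls_of_unions_centrally_symmetric_iff_congruent_balls
    (d : ℕ) (hd : 2 ≤ d) (K L : Set (Euc d))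
    (hKcl : IsClosed K) (hKconv : Convex ℝ K) (hKint : (interior K).Nonempty)
    (hKne : K ≠ univ)
    (hLcl : IsClosed L) (hLconv : Convex ℝ L) (hLint : (interior L).Nonempty)
    (hLne : L ≠ univ)
    (hKsm : SmoothBody K) (hLsm : SmoothBody L)
    (hKsp : SupportSpheres K) (hLsp : SupportSpheres L) :
    (∀ φ ψ : Euc d ≃ᵃⁱ[ℝ] Euc d,
        OrientationPreserving φ → OrientationPreserving ψ →
        CentrallySymmetric (closure (convexHull ℝ (φ '' K ∪ ψ '' L)))) ↔
    (∃ r : ℝ, 0 < r ∧ ∃ c c' : Euc d, K = closedBall c r ∧ L = closedBall c' r) := by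
  have hE : 2 ≤ Module.finrank ℝ (Euc d) := by simpa using hd
  constructor
  · intro h
    have hKne' := hKint.mono interior_subset
    have hLne' := hLint.mono interior_subset
    have hKb := hKsp.isBounded hKne' hKne
    have hLb := hLsp.isBounded hLne' hLne
    have hlin : ∀ A : Euc d ≃ₗᵢ[ℝ] Euc d,
        LinearMap.det (A.toLinearEquiv : Euc d →ₗ[ℝ] Euc d) = 1 →
        ∃ w : Euc d, ∀ u, supportFun (A '' L) u - supportFun K (-u) = ⟪w, u⟫_ℝ := by
      intro A hA
      refine exists_supportFun_sub_eq_inner hE hKb hKne'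
        (A.lipschitz.isBounded_image hLb) (hLne'.image _) fun v => ?_
      have := h (AffineIsometryEquiv.refl ℝ (Euc d))
        (A.toAffineIsometryEquiv.trans (AffineIsometryEquiv.constVAdd ℝ (Euc d) v))
        LinearMap.det_id hA
      simpa [CentrallySymmetric, image_image] using this
    obtain ⟨w₀, hw₀⟩ := hlin (LinearIsometryEquiv.refl ℝ (Euc d)) LinearMap.det_id
    simp only [LinearIsometryEquiv.coe_refl, image_id] at hw₀
    have hLcomp : IsCompact L := isCompact_of_isClosed_isBounded hLcl hLb
    obtain ⟨r, hr, hLball⟩ := eq_closedBall_of_rotation_invariant_s4 hE hLcomp hLconv hLint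
      (⨍ x in L, x) fun A hA x hx => by
        obtain ⟨w, hw⟩ := hlin A hA
        have hAb : Bornology.IsBounded (A '' L) := A.lipschitz.isBounded_image hLb
        have himage : (fun x => A x - (w - w₀)) '' L = L := by
          have hcomp : (fun x => A x - (w - w₀)) '' L = (fun x => -(w - w₀) + x) '' (A '' L) := by
            rw [image_image]
            exact image_congr fun x _ => by abel
          have hc : IsCompact ((fun x => A x - (w - w₀)) '' L) := hLcomp.image (by fun_prop)
          refine eq_of_supportFun_eq hc.isBounded (hLne'.image _) ?_ hc.isClosed
            hLb hLne' hLconv hLcl fun u => ?_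
          · rw [hcomp]
            exact (hLconv.linear_image A.toLinearEquiv.toLinearMap).translate _
          · rw [hcomp, supportFun_image_add hAb (hLne'.image _), inner_neg_left, inner_sub_left]
            linarith [hw u, hw₀ u]
        have hfix := setAverage_fixed_of_image_eq hLcomp hLint A _ himage
        rw [map_sub]
        have hmem : A x - (w - w₀) ∈ L := himage ▸ mem_image_of_mem _ hx
        convert hmem using 1
        nth_rewrite 1 [← hfix]
        abel
    set p : Euc d := ⨍ x in L, x
    refine ⟨r, hr, w₀ - p, p, ?_, hLball⟩
    have himage : (fun x => w₀ - x) '' L = closedBall (w₀ - p) r := by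
      rw [hLball]
      exact (IsometryEquiv.subLeft w₀).image_closedBall p r
    rw [← himage]
    have hc : IsCompact ((fun x => w₀ - x) '' L) := hLcomp.image (by fun_prop)
    refine eq_of_supportFun_eq hKb hKne' hKconv hKcl hc.isBounded (hLne'.image _) ?_ hc.isClosed
      fun u => ?_
    · rw [himage]
      exact convex_closedBall _ _
    · have := hw₀ (-u)
      rw [neg_neg, inner_neg_right] at this
      rw [supportFun_image_sub hLb hLne']
      linarith
  · rintro ⟨r, -, c, c', rfl, rfl⟩ φ ψ - -
    rw [image_closedBall_affineIsometryEquiv, image_closedBall_affineIsometryEquiv]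
    exact centrallySymmetric_closure_convexHull_union_closedBall _ _ r
end
end

section
/- Let d ≥ 2, let K ⊆ ℝ^d be a closed convex set with nonempty interior and K ≠ ℝ^d, and let r > 0. Suppose that every point x of the frontier of K has a relatively open neighbourhood in the frontier of K which is a relatively open subset of some sphere of radius r; precisely, for every x ∈ frontier K there exist ε > 0 and a point c ∈ ℝ^d such that ball(x, ε) ∩ frontier K = ball(x, ε) ∩ sphere(c, r). Then K is a closed ball of radius r, i.e. there exists c₀ with K = closedBall(c₀, r). -/
open Metric Set

noncomputable section

open Filter Topology in
/-- In dimension at least two, a sphere of given radius is determined by its germ at any of its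
points. -/
theorem eq_of_eventually_mem_sphere {d : ℕ} (hd : 2 ≤ d) {r : ℝ} (hr : 0 < r) {c c' z : Euc d}
    (hz : z ∈ sphere c r) (h : ∀ᶠ w in 𝓝 z, w ∈ sphere c r → w ∈ sphere c' r) : c = c' := by
  by_contra hne
  obtain ⟨e, he, he0⟩ : ∃ e ∈ (Submodule.span ℝ {c' - c})ᗮ, e ≠ 0 := by
    apply Submodule.exists_mem_ne_zero_of_ne_bot
    intro hbot
    have hdim := Submodule.finrank_add_finrank_orthogonal (Submodule.span ℝ {c' - c})
    rw [hbot, finrank_bot, finrank_span_singleton (sub_ne_zero.2 (Ne.symm hne)),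
      finrank_euclideanSpace_fin] at hdim
    omega
  rw [Submodule.mem_orthogonal_singleton_iff_inner_left] at he
  set u := c' - c with hu
  set v := z - c with hv
  have hvr : ‖v‖ = r := by simpa [hv, dist_eq_norm] using hz
  have hu0 : 0 < ‖u‖ ^ 2 := by
    have : u ≠ 0 := sub_ne_zero.2 (Ne.symm hne)
    positivity
  have key : ∀ w : Euc d, w ∈ sphere c r → w ∈ sphere c' r →
      2 * inner ℝ (w - c) u = ‖u‖ ^ 2 := by
    intro w hw hw'
    have h1 : ‖w - c‖ = r := by simpa [dist_eq_norm] using hw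
    have h2 : ‖(w - c) - u‖ = r := by simpa [hu, dist_eq_norm] using hw'
    have h3 := norm_sub_sq_real (w - c) u
    rw [h1, h2] at h3
    linarith
  have hvu : 2 * inner ℝ v u = ‖u‖ ^ 2 := key z hz (h.self_of_nhds hz)
  let f : ℝ → Euc d := fun s => c + (r / ‖v + s • e‖) • (v + s • e)
  have hv0 : ‖v‖ ≠ 0 := by rw [hvr]; exact hr.ne'
  have hf0 : f 0 = z := by
    simp only [f, zero_smul, add_zero, hvr, div_self hr.ne', one_smul]
    exact add_sub_cancel c z
  have hf : Tendsto f (𝓝 0) (𝓝 z) := by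
    rw [← hf0]
    have : ContinuousAt f 0 := by
      have : ‖v + (0 : ℝ) • e‖ ≠ 0 := by simpa using hv0
      fun_prop (disch := assumption)
    exact this
  have hne0 : ∀ᶠ s : ℝ in 𝓝 0, ‖v + s • e‖ ≠ 0 := by
    have : ContinuousAt (fun s : ℝ => ‖v + s • e‖) 0 := by fun_prop
    exact this.eventually_ne (by simpa using hv0)
  have hnorm : ∀ᶠ s : ℝ in 𝓝 0, ‖v + s • e‖ ^ 2 = r ^ 2 := by
    filter_upwards [hf.eventually h, hne0] with s hs hs0
    have hmem : f s ∈ sphere c r := by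
      rw [mem_sphere, dist_eq_norm, add_sub_cancel_left, norm_smul, Real.norm_eq_abs,
        abs_of_nonneg (by positivity), div_mul_cancel₀ _ hs0]
    have h1 := key _ hmem (hs hmem)
    simp only [f, add_sub_cancel_left, inner_smul_left, inner_add_left, he] at h1
    simp only [map_div₀, conj_trivial, mul_zero, add_zero] at h1
    have h2 : r / ‖v + s • e‖ = 1 := by
      have h4 : (r / ‖v + s • e‖) * ‖u‖ ^ 2 = 1 * ‖u‖ ^ 2 := by
        rw [← hvu]; linarith
      exact mul_right_cancel₀ hu0.ne' h4
    rw [div_eq_one_iff_eq hs0] at h2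
    rw [← h2]
  have hneg : ∀ᶠ s : ℝ in 𝓝 0, ‖v + (-s) • e‖ ^ 2 = r ^ 2 := by
    have : Tendsto (fun s : ℝ => -s) (𝓝 0) (𝓝 0) := by
      simpa using (continuous_neg (G := ℝ)).tendsto 0
    exact this.eventually hnorm
  obtain ⟨s, ⟨h1, h2⟩, hs⟩ :=
    (((hnorm.and hneg).filter_mono nhdsWithin_le_nhds).and
      (self_mem_nhdsWithin : Ioi (0 : ℝ) ∈ 𝓝[>] 0)).exists
  rw [norm_add_sq_real, hvr, inner_smul_right, norm_smul, mul_pow] at h1 h2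
  have hse : 0 < ‖s‖ ^ 2 * ‖e‖ ^ 2 := by
    have : s ≠ 0 := ne_of_gt hs
    positivity
  rw [norm_neg] at h2
  linarith

open Filter Topology in
/-- If a closed set `F` locally agrees near each of its points with some sphere of radius `r`,
then it contains each sphere of radius `r` with which it agrees near some point. -/
theorem sphere_subset_of_locally_spherical {d : ℕ} (hd : 2 ≤ d) {r : ℝ} (hr : 0 < r)
    {F : Set (Euc d)} (hF : IsClosed F)
    (hloc : ∀ x ∈ F, ∃ c : Euc d, ∀ᶠ w in 𝓝 x, w ∈ F ↔ w ∈ sphere c r)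
    {x c : Euc d} (hx : x ∈ F) (hc : ∀ᶠ w in 𝓝 x, w ∈ F ↔ w ∈ sphere c r) :
    sphere c r ⊆ F := by
  set U : Set (Euc d) := {y | ∀ᶠ w in 𝓝 y, w ∈ F ↔ w ∈ sphere c r} with hU
  have hUo : IsOpen U := isOpen_setOfPred_eventually_nhds
  have hUF : sphere c r ∩ U ⊆ F := fun y hy => (Eventually.self_of_nhds hy.2).2 hy.1
  have hcl : closure (sphere c r ∩ U) ⊆ U := by
    intro y hy
    obtain ⟨c', hc'⟩ := hloc y (closure_minimal hUF hF hy)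
    obtain ⟨z, ⟨hzS, hzU⟩, hz⟩ :=
      ((mem_closure_iff_frequently.1 hy).and_eventually hc'.eventually_nhds).exists
    have : c = c' := eq_of_eventually_mem_sphere hd hr hzS <| by
      filter_upwards [hz, hzU] with w h1 h2 h3 using h1.1 (h2.2 h3)
    rw [this] at hU
    rw [hU]
    exact hc'
  have hrank : 1 < Module.rank ℝ (Euc d) := by
    rw [← Module.finrank_eq_rank, finrank_euclideanSpace_fin]
    exact_mod_cast hd
  have hconn := isPreconnected_sphere hrank c r
  intro y hy
  by_contra hyF
  obtain ⟨z, hzS, hzU, hzV⟩ := hconn U (closure (sphere c r ∩ U))ᶜ hUo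
    isClosed_closure.isOpen_compl
    (fun w hw => or_iff_not_imp_right.2 fun h => hcl (not_not.1 h))
    ⟨x, hc.self_of_nhds.1 hx, hc⟩
    ⟨y, hy, fun h => hyF (closure_minimal hUF hF h)⟩
  exact hzV (subset_closure ⟨hzS, hzU⟩)

/-- A closed convex set whose frontier contains a sphere is the corresponding closed ball. -/
theorem eq_closedBall_of_sphere_subset_frontier {d : ℕ} (hd : 2 ≤ d) {r : ℝ} (hr : 0 < r)
    {K : Set (Euc d)} (hKcl : IsClosed K) (hKconv : Convex ℝ K) {c : Euc d}
    (h : sphere c r ⊆ frontier K) : K = closedBall c r := by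
  have : Nontrivial (Euc d) := by
    apply Module.nontrivial_of_finrank_pos (R := ℝ)
    rw [finrank_euclideanSpace_fin]
    omega
  have hsub : closedBall c r ⊆ K := by
    rw [← convexHull_sphere_eq_closedBall c hr.le]
    exact convexHull_min (h.trans hKcl.frontier_subset) hKconv
  refine Subset.antisymm (fun p hp => ?_) hsub
  by_contra hpc
  rw [mem_closedBall, dist_eq_norm, not_le] at hpc
  have hp0 : 0 < ‖p - c‖ := hr.trans hpc
  have hcint : c ∈ interior K :=
    interior_mono hsub (ball_subset_interior_closedBall (mem_ball_self hr))
  have hy : AffineMap.lineMap c p (r / ‖p - c‖) ∈ sphere c r := by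
    simp [AffineMap.lineMap_apply, norm_smul, abs_of_pos hr,
      div_mul_cancel₀ _ hp0.ne']
  refine (h hy).2 (hKconv.openSegment_interior_self_subset_interior hcint hp ?_)
  rw [openSegment_eq_image_lineMap]
  exact mem_image_of_mem _ ⟨div_pos hr hp0, (div_lt_one hp0).2 hpc⟩

/-- If every boundary point of a closed convex set with nonempty interior has a
relative neighbourhood on its boundary lying on a sphere of radius `r`, then the set is
a closed ball of radius `r`. -/
theorem closed_ball_of_locally_spherical_boundary
    (d : ℕ) (hd : 2 ≤ d) (K : Set (Euc d))
    (hKcl : IsClosed K) (hKconv : Convex ℝ K) (hKint : (interior K).Nonempty)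
    (hKne : K ≠ univ) (r : ℝ) (hr : 0 < r)
    (hloc : ∀ x ∈ frontier K, ∃ ε : ℝ, 0 < ε ∧ ∃ c : Euc d,
        ball x ε ∩ frontier K = ball x ε ∩ sphere c r) :
    ∃ c₀ : Euc d, K = closedBall c₀ r := by
  have hloc' : ∀ x ∈ frontier K, ∃ c : Euc d,
      ∀ᶠ w in nhds x, w ∈ frontier K ↔ w ∈ sphere c r := by
    intro x hx
    obtain ⟨ε, hε, c, h⟩ := hloc x hx
    refine ⟨c, Filter.eventually_of_mem (ball_mem_nhds x hε) fun w hw => ?_⟩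
    simpa [hw] using Set.ext_iff.1 h w
  obtain ⟨x, hx⟩ := nonempty_frontier_iff.2 ⟨hKint.mono interior_subset, hKne⟩
  obtain ⟨c, hc⟩ := hloc' x hx
  exact ⟨c, eq_closedBall_of_sphere_subset_frontier hd hr hKcl hKconv
    (sphere_subset_of_locally_spherical hd hr isClosed_frontier hloc' hx hc)⟩
end
end

section
/- Let d ≥ 2, let O ∈ ℝ^d and R > 0, and let K, L ⊆ ℝ^d be compact convex sets contained in the closed ball of radius R about O. Let p be a point of the sphere of radius R about O and set q = 2O − p (the antipodal point). Assume K ∩ sphere(O, R) = {p} and L ∩ sphere(O, R) = {q}. If c is a centre of symmetry of the convex hull of K ∪ L, i.e. the point reflection x ↦ 2c − x maps conv(K ∪ L) onto itself, then c = O. -/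
open Metric Set

noncomputable section

/-- If `K` and `L` lie in a ball of radius `R` about `O` and touch the bounding sphere
exactly in two antipodal points, then the only possible centre of symmetry of the convex
hull of their union is `O`. -/
theorem centre_of_symmetry_of_convexHull_union_eq_center
    (d : ℕ) (hd : 2 ≤ d) (O : Euc d) (R : ℝ) (hR : 0 < R) (K L : Set (Euc d))
    (hKcomp : IsCompact K) (hKconv : Convex ℝ K) (hKsub : K ⊆ closedBall O R)
    (hLcomp : IsCompact L) (hLconv : Convex ℝ L) (hLsub : L ⊆ closedBall O R)
    (p : Euc d) (hp : p ∈ sphere O R) (q : Euc d) (hq : q = (2 : ℝ) • O - p)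
    (hKp : K ∩ sphere O R = {p}) (hLq : L ∩ sphere O R = {q})
    (c : Euc d)
    (hc : (fun x => (2 : ℝ) • c - x) '' convexHull ℝ (K ∪ L) = convexHull ℝ (K ∪ L)) :
    c = O := by
  have hsub : convexHull ℝ (K ∪ L) ⊆ closedBall O R :=
    convexHull_min (union_subset hKsub hLsub) (convex_closedBall O R)
  have hreflect {x : Euc d} (hx : x ∈ K ∪ L) : ‖(2 : ℝ) • c - x - O‖ ≤ R := by
    rw [← dist_eq_norm]
    exact hsub (hc ▸ mem_image_of_mem _ (subset_convexHull ℝ _ hx))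
  have hpK : p ∈ K := (hKp.symm ▸ mem_singleton p : p ∈ K ∩ sphere O R).1
  have hqL : q ∈ L := (hLq.symm ▸ mem_singleton q : q ∈ L ∩ sphere O R).1
  have h₁ := hreflect (Or.inl hpK)
  have h₂ := hreflect (Or.inr hqL)
  have hnorm : ‖p - O‖ = R := by rwa [mem_sphere, dist_eq_norm] at hp
  have e₁ : (2 : ℝ) • c - p - O = (2 : ℝ) • (c - O) - (p - O) := by module
  have e₂ : (2 : ℝ) • c - q - O = (2 : ℝ) • (c - O) + (p - O) := by rw [hq]; module
  rw [e₁] at h₁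
  rw [e₂] at h₂
  have hpar := parallelogram_law_with_norm ℝ ((2 : ℝ) • (c - O)) (p - O)
  rw [hnorm, norm_smul, Real.norm_ofNat] at hpar
  have hzero : ‖c - O‖ = 0 := by
    nlinarith [norm_nonneg (c - O), mul_self_le_mul_self (norm_nonneg _) h₁,
      mul_self_le_mul_self (norm_nonneg _) h₂]
  exact sub_eq_zero.mp (norm_eq_zero.mp hzero)
end
end

section
/- Let d ≥ 2, let O ∈ ℝ^d and R > 0, and let K, L ⊆ ℝ^d be compact convex sets with nonempty interior contained in the closed ball of radius R about O. Let p be a point of the sphere of radius R about O and set q = 2O − p. Assume K ∩ sphere(O, R) = {p}, L ∩ sphere(O, R) = {q}, and that K is smooth (every point of the frontier of K has a unique supporting hyperplane). Then there exists δ > 0 such that ball(p, δ) ∩ frontier K = ball(p, δ) ∩ frontier (conv(K ∪ L)); that is, near p the boundary of K and the boundary of the convex hull of K ∪ L coincide. -/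
open Metric Set

noncomputable section

/-- A nonzero continuous linear functional attains no maximum over a set at an interior point. -/
theorem notMem_interior_of_forall_le {E : Type*} [NormedAddCommGroup E] [NormedSpace ℝ E]
    {K : Set E} {x : E} {f : E →L[ℝ] ℝ} (hf : f ≠ 0) (hmax : ∀ y ∈ K, f y ≤ f x) :
    x ∉ interior K := by
  intro hx
  have hloc : IsLocalMax f x := by
    filter_upwards [mem_interior_iff_mem_nhds.1 hx] with y hy using hmax y hy
  exact hf (hloc.hasFDerivAt_eq_zero f.hasFDerivAt)

/-- A convex set with nonempty interior has a supporting functional of norm one at every point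
outside its interior. -/
theorem exists_norm_eq_one_forall_le {E : Type*} [NormedAddCommGroup E] [NormedSpace ℝ E]
    {K : Set E} (hK : Convex ℝ K) (hint : (interior K).Nonempty) {x : E} (hx : x ∉ interior K) :
    ∃ f : E →L[ℝ] ℝ, ‖f‖ = 1 ∧ ∀ y ∈ K, f y ≤ f x := by
  obtain ⟨f, hf⟩ := geometric_hahn_banach_open_point hK.interior isOpen_interior hx
  have hf0 : f ≠ 0 := by
    rintro rfl
    obtain ⟨z, hz⟩ := hint
    simpa using hf z hz
  have hle : ∀ y ∈ K, f y ≤ f x := by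
    intro y hy
    have hmem : y ∈ closure (interior K) := by
      rw [hK.closure_interior_eq_closure_of_nonempty_interior hint]
      exact subset_closure hy
    exact closure_minimal (fun z hz => (hf z hz).le)
      (isClosed_le f.continuous continuous_const) hmem
  refine ⟨‖f‖⁻¹ • f, norm_smul_inv_norm (𝕜 := ℝ) hf0, fun y hy => ?_⟩
  have h := mul_le_mul_of_nonneg_left (hle y hy) (inv_nonneg.2 (norm_nonneg f))
  simpa using h

open Filter Topology in
/-- If every norm-one functional supporting `K` at `p` is strictly larger at `p` than on the
compact set `L`, then the same holds at all points near `p`. -/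
theorem exists_ball_forall_support_lt {E : Type*} [NormedAddCommGroup E] [NormedSpace ℝ E]
    [FiniteDimensional ℝ E] {K L : Set E} (hL : IsCompact L) {p : E}
    (h : ∀ f : E →L[ℝ] ℝ, ‖f‖ = 1 → (∀ y ∈ K, f y ≤ f p) → ∀ y ∈ L, f y < f p) :
    ∃ δ : ℝ, 0 < δ ∧ ∀ x ∈ ball p δ, ∀ f : E →L[ℝ] ℝ, ‖f‖ = 1 → (∀ y ∈ K, f y ≤ f x) →
      ∀ y ∈ L, f y < f x := by
  by_contra! hcon
  choose x hx f hf hfK y hyL hfy using fun n : ℕ =>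
    hcon (1 / ((n : ℝ) + 1)) Nat.one_div_pos_of_nat
  have hxp : Tendsto x atTop (𝓝 p) := by
    rw [tendsto_iff_dist_tendsto_zero]
    exact squeeze_zero (fun _ => dist_nonneg) (fun n => (hx n).le)
      tendsto_one_div_add_atTop_nhds_zero_nat
  have : ProperSpace (E →L[ℝ] ℝ) := FiniteDimensional.proper ℝ _
  obtain ⟨⟨g, z⟩, ⟨hg, hz⟩, φ, hφ, hlim⟩ :=
    ((isCompact_sphere (0 : E →L[ℝ] ℝ) 1).prod hL).tendsto_subseq
      (x := fun n => (f n, y n)) (fun n => ⟨by simpa using hf n, hyL n⟩)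
  have hlimf : Tendsto (fun n => f (φ n)) atTop (𝓝 g) := hlim.fst_nhds
  have hlimy : Tendsto (fun n => y (φ n)) atTop (𝓝 z) := hlim.snd_nhds
  have happ {u : ℕ → E} {v : E} (hu : Tendsto u atTop (𝓝 v)) :
      Tendsto (fun n => f (φ n) (u n)) atTop (𝓝 (g v)) :=
    (isBoundedBilinearMap_apply.continuous.tendsto (g, v)).comp (hlimf.prodMk_nhds hu)
  have hlimx := happ (hxp.comp hφ.tendsto_atTop)
  have hgK : ∀ w ∈ K, g w ≤ g p := fun w hw =>
    le_of_tendsto_of_tendsto' (happ tendsto_const_nhds) hlimx fun n => hfK (φ n) w hw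
  exact (h g (by simpa using hg) hgK z hz).not_ge
    (le_of_tendsto_of_tendsto' hlimx (happ hlimy) fun n => hfy (φ n))

/-- The inner product with the outer normal of a sphere at `p` is larger at `p` than at any other
point of the closed ball. -/
theorem inner_sub_lt_of_mem_closedBall {E : Type*} [NormedAddCommGroup E] [InnerProductSpace ℝ E]
    {O p y : E} {R : ℝ} (hp : p ∈ sphere O R) (hy : y ∈ closedBall O R) (hne : y ≠ p) :
    inner ℝ (p - O) y < inner ℝ (p - O) p := by
  rw [mem_sphere_iff_norm] at hp
  rw [mem_closedBall_iff_norm] at hy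
  have hpos : 0 < ‖(p - O) - (y - O)‖ := by
    rw [sub_sub_sub_cancel_right]
    exact norm_sub_pos_iff.2 hne.symm
  have hexp := norm_sub_sq_real (p - O) (y - O)
  have hsq : ‖y - O‖ ^ 2 ≤ R ^ 2 := by gcongr
  have hself := real_inner_self_eq_norm_sq (p - O)
  rw [hp] at hexp hself
  rw [inner_sub_right] at hexp hself
  nlinarith [pow_pos hpos 2]

/-- The convex hull of the union of two nonempty compact convex sets is compact. -/
theorem isCompact_convexHull_union {E : Type*} [NormedAddCommGroup E] [NormedSpace ℝ E]
    {K L : Set E} (hK : IsCompact K) (hKconv : Convex ℝ K) (hKne : K.Nonempty)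
    (hL : IsCompact L) (hLconv : Convex ℝ L) (hLne : L.Nonempty) :
    IsCompact (convexHull ℝ (K ∪ L)) := by
  have himage : convexHull ℝ (K ∪ L) =
      (fun z : ℝ × E × E => (1 - z.1) • z.2.1 + z.1 • z.2.2) '' (Icc 0 1 ×ˢ K ×ˢ L) := by
    ext x
    rw [hKconv.convexHull_union hLconv hKne hLne, mem_convexJoin]
    simp only [segment_eq_image, mem_image, mem_prod, Prod.exists]
    exact ⟨fun ⟨k, hk, l, hl, t, ht, hx⟩ => ⟨t, k, l, ⟨ht, hk, hl⟩, hx⟩,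
      fun ⟨t, k, l, ⟨ht, hk, hl⟩, hx⟩ => ⟨k, hk, l, hl, t, ht, hx⟩⟩
  rw [himage]
  exact (isCompact_Icc.prod (hK.prod hL)).image (by fun_prop)

/-- If, at every point near `p`, the norm-one functionals supporting `K` are strictly larger there
than on `L`, then `K` and the convex hull of `K ∪ L` have the same frontier near `p`. -/
theorem ball_inter_frontier_eq_of_forall_support_lt {E : Type*} [NormedAddCommGroup E]
    [NormedSpace ℝ E] {K L : Set E} (hK : IsClosed K) (hKconv : Convex ℝ K)
    (hKint : (interior K).Nonempty) (hLconv : Convex ℝ L) (hL : L.Nonempty)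
    (hC : IsClosed (convexHull ℝ (K ∪ L))) {p : E} {δ : ℝ}
    (h : ∀ x ∈ ball p δ, ∀ f : E →L[ℝ] ℝ, ‖f‖ = 1 → (∀ y ∈ K, f y ≤ f x) →
      ∀ y ∈ L, f y < f x) :
    ball p δ ∩ frontier K = ball p δ ∩ frontier (convexHull ℝ (K ∪ L)) := by
  have hKC : K ⊆ convexHull ℝ (K ∪ L) := subset_union_left.trans (subset_convexHull ℝ _)
  ext x
  simp only [mem_inter_iff, and_congr_right_iff, hK.frontier_eq, hC.frontier_eq, mem_sdiff]
  refine fun hx => ⟨fun ⟨hxK, hxi⟩ => ⟨hKC hxK, ?_⟩, fun ⟨hxC, hxi⟩ => ⟨?_, ?_⟩⟩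
  · obtain ⟨f, hf, hfK⟩ := exists_norm_eq_one_forall_le hKconv hKint hxi
    have hf0 : f ≠ 0 := norm_ne_zero_iff.1 (by simp [hf])
    refine notMem_interior_of_forall_le hf0 fun y hy => ?_
    refine convexHull_min (union_subset hfK fun z hz => (h x hx f hf hfK z hz).le)
      (convex_halfSpace_le f.toLinearMap.isLinear (f x)) hy
  · obtain ⟨f, hf, hfC⟩ := exists_norm_eq_one_forall_le (convex_convexHull ℝ (K ∪ L))
      (hKint.mono (interior_mono hKC)) hxi
    have hfK : ∀ y ∈ K, f y ≤ f x := fun y hy => hfC y (hKC hy)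
    rw [hKconv.convexHull_union hLconv (hKint.mono interior_subset) hL, mem_convexJoin] at hxC
    obtain ⟨k, hk, l, hl, a, b, ha, hb, hab, rfl⟩ := hxC
    have hfl := h _ hx f hf hfK l hl
    have hfk := hfK k hk
    rcases hb.eq_or_lt with rfl | hb
    · obtain rfl : a = 1 := by linarith
      simpa using hk
    · simp only [map_add, map_smul, smul_eq_mul] at hfl hfk
      have h₁ := mul_le_mul_of_nonneg_left hfk ha
      have h₂ := mul_lt_mul_of_pos_left hfl hb
      have h₃ := congrArg (· * (a * f k + b * f l)) hab
      linarith
  · exact fun hxK => hxi (interior_mono hKC hxK)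

/-- Near the touching point `p`, the boundary of `K` coincides with the boundary of the
convex hull of `K ∪ L`. -/
theorem frontier_convexHull_union_coincides_near_touching_point
    (d : ℕ) (hd : 2 ≤ d) (O : Euc d) (R : ℝ) (hR : 0 < R) (K L : Set (Euc d))
    (hKcomp : IsCompact K) (hKconv : Convex ℝ K) (hKint : (interior K).Nonempty)
    (hKsub : K ⊆ closedBall O R)
    (hLcomp : IsCompact L) (hLconv : Convex ℝ L) (hLint : (interior L).Nonempty)
    (hLsub : L ⊆ closedBall O R)
    (p : Euc d) (hp : p ∈ sphere O R) (q : Euc d) (hq : q = (2 : ℝ) • O - p)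
    (hKp : K ∩ sphere O R = {p}) (hLq : L ∩ sphere O R = {q})
    (hKsm : SmoothBody K) :
    ∃ δ : ℝ, 0 < δ ∧
      ball p δ ∩ frontier K = ball p δ ∩ frontier (convexHull ℝ (K ∪ L)) := by
  have hpK : p ∈ K := (hKp.symm ▸ mem_singleton p : p ∈ K ∩ sphere O R).1
  have hpL : p ∉ L := by
    intro hpL
    have hpq : p = q := hLq.subset ⟨hpL, hp⟩
    have hpO : p = O := by
      rw [hq, two_smul, eq_sub_iff_add_eq, ← two_smul ℝ, ← two_smul ℝ] at hpq
      exact smul_right_injective _ two_ne_zero hpq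
    rw [hpO, mem_sphere, dist_self] at hp
    exact hR.ne hp
  have hnorm : ‖p - O‖ = R := mem_sphere_iff_norm.1 hp
  have hn0 : innerSL ℝ (p - O) ≠ 0 := norm_ne_zero_iff.1 (by
    rw [innerSL_apply_norm, hnorm]
    exact hR.ne')
  have hnK : ∀ y ∈ K, innerSL ℝ (p - O) y ≤ innerSL ℝ (p - O) p := by
    intro y hy
    rcases eq_or_ne y p with rfl | hne
    · exact le_rfl
    · exact (inner_sub_lt_of_mem_closedBall hp (hKsub hy) hne).le
  have hpf : p ∈ frontier K := by
    rw [hKcomp.isClosed.frontier_eq]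
    exact ⟨hpK, notMem_interior_of_forall_le hn0 hnK⟩
  have hunit : IsUnitSupportFunctional K p (R⁻¹ • innerSL ℝ (p - O)) := by
    constructor
    · rw [norm_smul, innerSL_apply_norm, hnorm, norm_inv, Real.norm_of_nonneg hR.le,
        inv_mul_cancel₀ hR.ne']
    · intro y hy
      exact mul_le_mul_of_nonneg_left (hnK y hy) (inv_nonneg.2 hR.le)
  obtain ⟨δ, hδ, h⟩ := exists_ball_forall_support_lt (K := K) hLcomp (p := p) (by
    intro f hf hfK y hy
    obtain rfl := (hKsm p hpf).unique ⟨hf, hfK⟩ hunit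
    exact mul_lt_mul_of_pos_left
      (inner_sub_lt_of_mem_closedBall hp (hLsub hy) (ne_of_mem_of_not_mem hy hpL))
      (inv_pos.2 hR))
  have hLne : L.Nonempty := hLint.mono interior_subset
  have hC : IsClosed (convexHull ℝ (K ∪ L)) :=
    (isCompact_convexHull_union hKcomp hKconv ⟨p, hpK⟩ hLcomp hLconv hLne).isClosed
  exact ⟨δ, hδ, ball_inter_frontier_eq_of_forall_support_lt hKcomp.isClosed hKconv hKint
    hLconv hLne hC h⟩
end
end

section
/- Let d ≥ 1, let K ⊆ ℝ^d be a convex set, let x ∈ ℝ^d and ρ > 0, and let z ∈ K with dist(z, x) < ρ. If z is an exposed point of K ∩ closedBall(x, ρ), then z is an exposed point of K. -/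
open Metric Set

noncomputable section

/-- `z` is an exposed point of `S`: a continuous linear functional attains its strict
maximum over `S` exactly at `z`. -/
def IsExposedPoint {d : ℕ} (S : Set (Euc d)) (z : Euc d) : Prop :=
  z ∈ S ∧ ∃ f : Euc d →L[ℝ] ℝ, ∀ y ∈ S, y ≠ z → f y < f z

/-- An exposed point of `K ∩ closedBall x ρ` lying in the open ball is an exposed point
of `K`. -/
theorem exposed_point_of_inter_closedBall
    (d : ℕ) (hd : 1 ≤ d) (K : Set (Euc d)) (hKconv : Convex ℝ K)
    (x : Euc d) (ρ : ℝ) (hρ : 0 < ρ) (z : Euc d) (hz : z ∈ K) (hzx : dist z x < ρ)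
    (hexp : IsExposedPoint (K ∩ closedBall x ρ) z) :
    IsExposedPoint K z := by
  obtain ⟨-, f, hf⟩ := hexp
  refine ⟨hz, f, fun y hy hyz => ?_⟩
  have hδ : 0 < ρ - dist z x := sub_pos.2 hzx
  have hn : 0 < ‖y - z‖ := norm_pos_iff.2 (sub_ne_zero.2 hyz)
  obtain ⟨t, ht₀, ht₁, htδ⟩ :
      ∃ t : ℝ, 0 < t ∧ t ≤ 1 ∧ t * ‖y - z‖ ≤ ρ - dist z x :=
    ⟨min 1 ((ρ - dist z x) / ‖y - z‖), lt_min one_pos (div_pos hδ hn), min_le_left _ _,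
      (le_div_iff₀ hn).1 (min_le_right _ _)⟩
  have hwK : z + t • (y - z) ∈ K := hKconv.add_smul_sub_mem hz hy ⟨ht₀.le, ht₁⟩
  have hwz : dist (z + t • (y - z)) z = t * ‖y - z‖ := by
    rw [dist_eq_norm, add_sub_cancel_left, norm_smul, Real.norm_of_nonneg ht₀.le]
  have hwx : z + t • (y - z) ∈ closedBall x ρ := by
    rw [mem_closedBall]
    linarith [dist_triangle (z + t • (y - z)) z x]
  have hne : z + t • (y - z) ≠ z := by
    rw [← dist_pos, hwz]
    positivity
  have hlt := hf _ ⟨hwK, hwx⟩ hne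
  rw [map_add, map_smul, map_sub, smul_eq_mul] at hlt
  nlinarith
end
end
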